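/- Fix integers m, n ≥ 1 and let M = 2m. In the ℚ(q)-algebra End(V^{⊗n}): (1) each of the operators 𝓑_i (i ∈ 𝕀_{2m−1}, i ≠ 0), 𝓑_0 and 𝓓_r^{±1} (r ∈ {1/2,…,m−1/2}) commutes with each of σ_0, …, σ_{n−1}; (2) the commutant of the unital subalgebra 𝒜 generated by {𝓑_i (i ≠ 0), 𝓑_0, 𝓓_r^{±1}} equals the unital subalgebra ℋ generated by {σ_0, …, σ_{n−1}}; (3) the commutant of ℋ equals 𝒜. (This is the ıSchur duality double centralizer property between the ıquantum group U^ı_m and the type B Hecke algebra ℋ_B(n) acting on V^{⊗n}; in particular the operators σ_0,…,σ_{n−1} generate End_{U^ı_m}(V^{⊗n}).) -/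

import Mathlib

open scoped BigOperators Classical

set_option synthInstance.maxHeartbeats 1000000
set_option maxHeartbeats 1000000

noncomputable section

/-- The base field `ℚ(q)`. -/
abbrev K : Type := RatFunc ℚ

/-- The indeterminate `q`. -/
def q : K := RatFunc.X

/-- The quantum integer `[r] = (q^r - q^{-r})/(q - q^{-1})`. -/
def qint (r : ℤ) : K := (q ^ r - q ^ (-r)) / (q - q⁻¹)

/-- The quantum factorial `[r]!`. -/
def qfac : ℕ → K
  | 0 => 1
  | n+1 => qfac n * qint (n+1)

/-- The index set `𝕀_N = {-(N-1)/2, -(N-3)/2, …, (N-1)/2}` as a finite set of rationals. -/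
def II (N : ℕ) : Finset ℚ := (Finset.range N).image (fun k : ℕ => (k : ℚ) - ((N : ℚ) - 1) / 2)

theorem II_neg {N : ℕ} {a : ℚ} (h : a ∈ II N) : -a ∈ II N := by
  obtain ⟨k, hk, hv⟩ := Finset.mem_image.mp h
  rw [Finset.mem_range] at hk
  refine Finset.mem_image.mpr ⟨N - 1 - k, Finset.mem_range.mpr (by omega), ?_⟩
  have h1 : ((N - 1 - k : ℕ) : ℚ) = (N : ℚ) - 1 - (k : ℚ) := by
    have h2 : (N : ℚ) = ((N - 1 - k : ℕ) : ℚ) + (k : ℚ) + 1 := by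
      exact_mod_cast congrArg (Nat.cast : ℕ → ℚ) (by omega : N = (N - 1 - k) + k + 1)
    linarith
  rw [h1, ← hv]; ring

/-- Basis index of `V`: elements of `𝕀_M`. -/
def SubI (M : ℕ) : Type := {a : ℚ // a ∈ II M}

/-- `V^{⊗n}`: free `ℚ(q)`-vector space on `n`-tuples from `𝕀_M`. -/
abbrev TV (n M : ℕ) : Type := (Fin n → SubI M) →₀ K

/-- Basis vector `v_λ`. -/
def tT {n M : ℕ} (l : Fin n → SubI M) : TV n M := Finsupp.single l 1

/-- A "single-target" operator on `V`: `v_a ↦ c a • v_{t a}`. -/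
structure SOp where
  t : ℚ → ℚ
  c : ℚ → K

def SOp.id' : SOp := ⟨fun a => a, fun _ => 1⟩
/-- Composite `O ∘ P`. -/
def SOp.comp (O P : SOp) : SOp := ⟨fun a => O.t (P.t a), fun a => P.c a * O.c (P.t a)⟩
/-- `E_i v_a = δ(a = i+1/2) v_{a-1}`. -/
def Eop (i : ℚ) : SOp := ⟨fun a => a - 1, fun a => if a = i + 1/2 then 1 else 0⟩
/-- `F_i v_a = δ(a = i-1/2) v_{a+1}`. -/
def Fop (i : ℚ) : SOp := ⟨fun a => a + 1, fun a => if a = i - 1/2 then 1 else 0⟩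
/-- A diagonal operator `v_a ↦ q^{f a} v_a`. -/
def diagOp (f : ℚ → ℤ) : SOp := ⟨fun a => a, fun a => q ^ f a⟩
/-- `K_i^{-1}` (diagonal). -/
def Kinv (i : ℚ) : SOp := diagOp fun a => (if a = i+1/2 then 1 else 0) - (if a = i-1/2 then 1 else 0)
/-- `K_i` (diagonal). -/
def Kpos (i : ℚ) : SOp := diagOp fun a => (if a = i-1/2 then 1 else 0) - (if a = i+1/2 then 1 else 0)
/-- `k_i^{-1} = K_i^{-1} K_{-i}`. -/
def kinv (i : ℚ) : SOp := (Kinv i).comp (Kpos (-i))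
/-- `k_i = K_i K_{-i}^{-1}`. -/
def kpos (i : ℚ) : SOp := (Kpos i).comp (Kinv (-i))
/-- `(D_r D_{-r})^e` (diagonal), `e = ±1`. -/
def DDop (r : ℚ) (e : ℤ) : SOp := diagOp fun a => e * ((if a = r then 1 else 0) + (if a = -r then 1 else 0))
/-- `D_0^e` (diagonal), `e = ±1`. -/
def D0op (e : ℤ) : SOp := diagOp fun a => e * (if a = 0 then 1 else 0)

/-- Tensor product `ops 0 ⊗ ops 1 ⊗ ⋯ ⊗ ops (n-1)` of single-target operators on `V^{⊗n}`. -/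
def tensorOp {n M : ℕ} (ops : Fin n → SOp) : TV n M →ₗ[K] TV n M :=
  Finsupp.lift (TV n M) K (Fin n → SubI M) fun l =>
    if h : ∀ r, (ops r).t (l r).1 ∈ II M then
      Finsupp.single (fun r => ⟨(ops r).t (l r).1, h r⟩) (∏ r, (ops r).c (l r).1)
    else 0

/-- `𝓑_i` on `V^{⊗n}`, for `i ≠ 0` (ı-case) resp. `i ∈ {1/2,…,m-1/2}` (ȷ-case). -/
def calB (n M : ℕ) (i : ℚ) : TV n M →ₗ[K] TV n M :=
  (∑ r : Fin n, tensorOp fun s => if s < r then SOp.id' else if s = r then Fop i else Kinv i)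
  + (∑ r : Fin n, tensorOp fun s => if s < r then kinv i else if s = r then (Eop (-i)).comp (Kinv i) else Kinv i)

/-- `𝓑_0` on `V^{⊗n}` (ı-case). -/
def calB0 (n M : ℕ) : TV n M →ₗ[K] TV n M :=
  (∑ r : Fin n, tensorOp fun s => if s < r then SOp.id' else if s = r then Fop 0 else Kinv 0)
  + q⁻¹ • (∑ r : Fin n, tensorOp fun s => if s < r then SOp.id' else if s = r then (Eop 0).comp (Kinv 0) else Kinv 0)
  + tensorOp fun _ => Kinv 0

/-- `𝓑_{-i}` on `V^{⊗n}` (ȷ-case), for `i ∈ {1/2,…,m-1/2}`. -/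
def calBn (n M : ℕ) (i : ℚ) : TV n M →ₗ[K] TV n M :=
  (∑ r : Fin n, tensorOp fun s => if s < r then SOp.id' else if s = r then Fop (-i) else Kinv (-i))
  + (∑ r : Fin n, tensorOp fun s => if s < r then kpos i else if s = r then (Kinv (-i)).comp (Eop i) else Kinv (-i))

/-- `𝓓_r^e = ((D_r D_{-r})^e)^{⊗n}`. -/
def calD (n M : ℕ) (r : ℚ) (e : ℤ) : TV n M →ₗ[K] TV n M := tensorOp fun _ => DDop r e

/-- `𝓓_0^e = (D_0^e)^{⊗n}`. -/
def calD0 (n M : ℕ) (e : ℤ) : TV n M →ₗ[K] TV n M := tensorOp fun _ => D0op e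

/-- Negation on `𝕀_M`. -/
def negS {M : ℕ} (a : SubI M) : SubI M := ⟨-a.1, II_neg a.2⟩

/-- `λ · s` where `s` interchanges the tensor positions `a` and `b`. -/
def swapL {n M : ℕ} (a b : Fin n) (l : Fin n → SubI M) : Fin n → SubI M := l ∘ Equiv.swap a b

/-- The Hecke operator `σ` acting in tensor positions `a, b` (for `a < b` adjacent). -/
def sigmaI {n M : ℕ} (a b : Fin n) : TV n M →ₗ[K] TV n M :=
  Finsupp.lift (TV n M) K (Fin n → SubI M) fun l =>
    if (l a).1 < (l b).1 then tT (swapL a b l)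
    else if (l a).1 = (l b).1 then q⁻¹ • tT l
    else tT (swapL a b l) + (q⁻¹ - q) • tT l

/-- The Hecke operator `σ_0`. -/
def sigma0 {n M : ℕ} (hn : 0 < n) : TV n M →ₗ[K] TV n M :=
  Finsupp.lift (TV n M) K (Fin n → SubI M) fun l =>
    if 0 < (l ⟨0, hn⟩).1 then tT (Function.update l ⟨0, hn⟩ (negS (l ⟨0, hn⟩)))
    else if (l ⟨0, hn⟩).1 = 0 then q⁻¹ • tT l
    else tT (Function.update l ⟨0, hn⟩ (negS (l ⟨0, hn⟩))) + (q⁻¹ - q) • tT l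

/-- `σ_i`, `0 ≤ i ≤ n-1` (for `i ≥ 1` it acts on the 1-based entries `λ_i, λ_{i+1}`). -/
def sigmaB {n M : ℕ} (hn : 0 < n) (i : ℕ) (hi : i < n) : TV n M →ₗ[K] TV n M :=
  if i = 0 then sigma0 hn else sigmaI ⟨i - 1, by omega⟩ ⟨i, hi⟩

/-- The generating set of operators of the ı-quantum group `U^ı_m` acting on `V^{⊗n}`:
the `𝓑_i` (`i ∈ 𝕀_{2m-1}`, `i ≠ 0`), `𝓑_0`, and the `𝓓_r^{±1}` (`r ∈ {1/2,…,m-1/2}`). -/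
def gensAι (m n : ℕ) : Set (Module.End K (TV n (2*m))) :=
  {O | (∃ i ∈ II (2*m - 1), i ≠ 0 ∧ O = calB n (2*m) i) ∨ O = calB0 n (2*m)
     ∨ (∃ r ∈ II (2*m), 0 < r ∧ (O = calD n (2*m) r 1 ∨ O = calD n (2*m) r (-1)))}

/-- The generating set `{σ_0, …, σ_{n-1}}` of the type B Hecke algebra action on `V^{⊗n}`. -/
def gensH (n M : ℕ) (hn : 0 < n) : Set (Module.End K (TV n M)) :=
  {O | ∃ i : ℕ, ∃ hi : i < n, O = sigmaB hn i hi}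

namespace IotaSchur

open Polynomial Matrix

section DoubleCommutant

variable {I : Type*} [Fintype I]

/-- The trace form `(A, B) ↦ tr (Aᵀ B)` on rational square matrices. -/
def traceForm (I : Type*) [Fintype I] : LinearMap.BilinForm ℚ (Matrix I I ℚ) :=
  LinearMap.mk₂ ℚ (fun A B => (Aᵀ * B).trace)
    (by intros; simp [add_mul]) (by intros; simp) (by intros; simp [mul_add]) (by intros; simp)

theorem traceForm_apply (A B : Matrix I I ℚ) : traceForm I A B = (Aᵀ * B).trace := rfl

theorem traceForm_self_eq_zero {A : Matrix I I ℚ} (h : traceForm I A A = 0) : A = 0 := by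
  rw [traceForm_apply, Matrix.trace] at h
  simp only [Matrix.diag_apply, Matrix.mul_apply, Matrix.transpose_apply] at h
  rw [Finset.sum_eq_zero_iff_of_nonneg
    (fun i _ => Finset.sum_nonneg fun j _ => mul_self_nonneg _)] at h
  ext i j
  have h1 := h j (Finset.mem_univ _)
  rw [Finset.sum_eq_zero_iff_of_nonneg (fun j _ => mul_self_nonneg _)] at h1
  exact mul_self_eq_zero.mp (h1 i (Finset.mem_univ _))

theorem traceForm_isRefl : (traceForm I).IsRefl := by
  intro A B h
  rw [traceForm_apply] at h ⊢
  rw [← Matrix.trace_transpose, Matrix.transpose_mul, Matrix.transpose_transpose, h]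

variable [DecidableEq I]

/-- A transpose-closed algebra of rational matrices contains its double commutant. -/
theorem mem_of_commutes_centralizer (H : Subalgebra ℚ (Matrix I I ℚ)) (hH : ∀ h ∈ H, hᵀ ∈ H)
    {T : Matrix I I ℚ} (hT : ∀ X, (∀ h ∈ H, X * h = h * X) → T * X = X * T) : T ∈ H := by
  set W : Submodule ℚ (Matrix I I ℚ) := Subalgebra.toSubmodule H with hW
  have hc : IsCompl W ((traceForm I).orthogonal W) := by
    rw [LinearMap.BilinForm.isCompl_orthogonal_iff_disjoint traceForm_isRefl,
      Submodule.disjoint_def]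
    intro A h1 h2
    exact traceForm_self_eq_zero (h2 A h1)
  set p := W.projection _ hc with hp
  have hpmul : ∀ h ∈ H, ∀ A, p (h * A) = h * p A := by
    intro h hh A
    have h1 : h * p A ∈ W := H.mul_mem hh (Submodule.projection_apply_mem hc A)
    have h2 : h * (A - p A) ∈ (traceForm I).orthogonal W := by
      intro g hg
      have h3 := Submodule.sub_projection_mem hc A (hᵀ * g) (H.mul_mem (hH h hh) hg)
      change traceForm I g _ = 0
      rw [traceForm_apply] at h3 ⊢
      simpa [Matrix.transpose_mul, Matrix.mul_assoc] using h3
    have h4 : h * A = h * p A + h * (A - p A) := by rw [← mul_add]; simp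
    rw [h4, map_add, (Submodule.projection_apply_eq_zero_iff hc).2 h2, add_zero]
    exact Submodule.projection_apply_of_mem_left hc h1
  have hsum : ∀ (h : Matrix I I ℚ) (l k : I),
      h * Matrix.single l k 1 = ∑ s, h s l • Matrix.single s k (1 : ℚ) := by
    intro h l k
    ext i j
    simp [Matrix.mul_apply, Matrix.single_apply, Matrix.sum_apply, ite_and]
  have hTp : ∀ l k : I, p (T * Matrix.single l k 1) = T * p (Matrix.single l k 1) := by
    intro l k
    ext i j
    have hX := hT (Matrix.of fun i l => p (Matrix.single l k 1) i j) (by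
      intro h hh
      ext i' l'
      have h1 := congrFun (congrFun (hpmul h hh (Matrix.single l' k 1)) i') j
      rw [hsum, map_sum] at h1
      simp only [map_smul, Matrix.sum_apply, Matrix.smul_apply, Matrix.mul_apply,
        smul_eq_mul] at h1
      simp only [Matrix.mul_apply, Matrix.of_apply]
      rw [← h1]
      exact Finset.sum_congr rfl fun _ _ => mul_comm _ _)
    have h2 := congrFun (congrFun hX i) l
    rw [hsum, map_sum]
    simp only [map_smul, Matrix.sum_apply, Matrix.smul_apply, Matrix.mul_apply,
        smul_eq_mul, Matrix.of_apply] at h2 ⊢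
    rw [h2]
    exact Finset.sum_congr rfl fun _ _ => mul_comm _ _
  have h1 : (1 : Matrix I I ℚ) = ∑ k, Matrix.single k k 1 := by
    ext i j
    simp [Matrix.sum_apply, Matrix.one_apply, Matrix.single_apply, ite_and]
  have h2 : p T = T := by
    have h3 : p (T * 1) = T * p 1 := by
      rw [h1, Finset.mul_sum, map_sum, map_sum, Finset.mul_sum]
      exact Finset.sum_congr rfl fun k _ => hTp k k
    rw [mul_one, Submodule.projection_apply_of_mem_left hc (x := 1) H.one_mem, mul_one] at h3
    exact h3
  rw [← h2]
  exact Submodule.projection_apply_mem hc T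

end DoubleCommutant

section Specialization

/-- Two nested subspaces of a `ℚ(q)`-vector space coincide as soon as, modulo `q - 1`, every
integral vector of the larger is congruent to an integral vector of the smaller. -/
theorem eq_of_le_of_congruent {E L : Type*} [AddCommGroup E] [Module K E] [AddCommGroup L]
    [Module ℚ[X] L] [IsNoetherian ℚ[X] L] (φ : L →+ E)
    (hφ : ∀ (d : ℚ[X]) (P : L), φ (d • P) = algebraMap ℚ[X] K d • φ P)
    (hden : ∀ x : E, ∃ d : ℚ[X], d ≠ 0 ∧ ∃ P, φ P = algebraMap ℚ[X] K d • x)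
    {S T : Submodule K E} (hST : S ≤ T)
    (h : ∀ P, φ P ∈ T → ∃ P', φ P' ∈ S ∧ ∃ Z, P - P' = (X - 1 : ℚ[X]) • Z) : S = T := by
  have hinj : ∀ d : ℚ[X], d ≠ 0 → algebraMap ℚ[X] K d ≠ 0 := fun d hd =>
    (map_ne_zero_iff _ (IsFractionRing.injective ℚ[X] K)).2 hd
  let pull : Submodule K E → Submodule ℚ[X] L := fun U =>
    { carrier := {P | φ P ∈ U}
      add_mem' := fun {a b} ha hb => by
        simp only [Set.mem_ofPred_eq, map_add] at *; exact U.add_mem ha hb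
      zero_mem' := by simp
      smul_mem' := fun d P hP => by
        simp only [Set.mem_ofPred_eq, hφ] at *; exact U.smul_mem _ hP }
  have hle : pull T ≤ pull S ⊔ (Ideal.span {(X - 1 : ℚ[X])}) • pull T := by
    intro P hP
    obtain ⟨P', hP', Z, hZ⟩ := h P hP
    have hX : (X - 1 : ℚ[X]) ≠ 0 := by simpa using Polynomial.X_sub_C_ne_zero (1 : ℚ)
    have hZT : φ Z ∈ T := by
      have h1 : φ ((X - 1 : ℚ[X]) • Z) ∈ T := by
        rw [← hZ, map_sub]; exact T.sub_mem hP (hST hP')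
      rw [hφ] at h1
      exact (T.smul_mem_iff (hinj _ hX)).1 h1
    rw [← sub_add_cancel P P', hZ, add_comm]
    exact Submodule.add_mem_sup hP'
      (Submodule.smul_mem_smul (Ideal.mem_span_singleton_self _) hZT)
  obtain ⟨r, hr, hrT⟩ := Submodule.exists_sub_one_mem_and_smul_le_of_fg_of_le_sup
    (I := Ideal.span {(X - 1 : ℚ[X])}) (N := pull S) (N' := pull T) (P := pull T)
    (IsNoetherian.noetherian _) le_rfl hle
  have hr0 : r ≠ 0 := by
    rintro rfl
    obtain ⟨c, hc⟩ := Ideal.mem_span_singleton.1 hr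
    have := congrArg (eval 1) hc
    simp at this
  refine le_antisymm hST fun x hx => ?_
  obtain ⟨d, hd, P, hP⟩ := hden x
  have hPT : P ∈ pull T := by
    change φ P ∈ T
    rw [hP]; exact T.smul_mem _ hx
  have h2 : φ (r • P) ∈ S := hrT (Submodule.smul_mem_pointwise_smul P r _ hPT)
  rw [hφ, hP] at h2
  exact (S.smul_mem_iff (hinj _ hd)).1 ((S.smul_mem_iff (hinj _ hr0)).1 h2)

/-- `z ∈ ℚ(q)` is regular at `q = 1` with value `c`. -/
def HasValue (z : K) (c : ℚ) : Prop :=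
  ∃ d P : ℚ[X], d.eval 1 = 1 ∧ algebraMap ℚ[X] K d * z = algebraMap ℚ[X] K P ∧ P.eval 1 = c

theorem HasValue.of_polynomial (P : ℚ[X]) : HasValue (algebraMap ℚ[X] K P) (P.eval 1) :=
  ⟨1, P, by simp, by simp, rfl⟩

theorem HasValue.zero : HasValue 0 0 := by simpa using HasValue.of_polynomial 0

theorem HasValue.one : HasValue 1 1 := by simpa using HasValue.of_polynomial 1

theorem HasValue.q : HasValue q 1 := by
  simpa [_root_.q] using HasValue.of_polynomial X

theorem HasValue.add {z w : K} {c d : ℚ} (hz : HasValue z c) (hw : HasValue w d) :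
    HasValue (z + w) (c + d) := by
  obtain ⟨a, P, ha, hP, rfl⟩ := hz
  obtain ⟨b, Q, hb, hQ, rfl⟩ := hw
  refine ⟨a * b, b * P + a * Q, by simp [ha, hb], ?_, by simp [ha, hb]⟩
  simp only [map_mul, map_add, ← hP, ← hQ]; ring

theorem HasValue.mul {z w : K} {c d : ℚ} (hz : HasValue z c) (hw : HasValue w d) :
    HasValue (z * w) (c * d) := by
  obtain ⟨a, P, ha, hP, rfl⟩ := hz
  obtain ⟨b, Q, hb, hQ, rfl⟩ := hw
  refine ⟨a * b, P * Q, by simp [ha, hb], ?_, by simp⟩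
  simp only [map_mul, ← hP, ← hQ]; ring

theorem HasValue.neg {z : K} {c : ℚ} (hz : HasValue z c) : HasValue (-z) (-c) := by
  obtain ⟨a, P, ha, hP, rfl⟩ := hz
  exact ⟨a, -P, ha, by simp [hP], by simp⟩

theorem HasValue.sub {z w : K} {c d : ℚ} (hz : HasValue z c) (hw : HasValue w d) :
    HasValue (z - w) (c - d) := by
  simpa only [sub_eq_add_neg] using hz.add hw.neg

theorem q_ne_zero : q ≠ 0 := RatFunc.X_ne_zero

theorem HasValue.q_inv : HasValue _root_.q⁻¹ 1 :=
  ⟨X, 1, by simp, by simpa [_root_.q] using mul_inv_cancel₀ q_ne_zero, by simp⟩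

theorem HasValue.sum {ι : Type*} (s : Finset ι) {z : ι → K} {c : ι → ℚ}
    (h : ∀ i ∈ s, HasValue (z i) (c i)) : HasValue (∑ i ∈ s, z i) (∑ i ∈ s, c i) := by
  induction s using Finset.induction_on with
  | empty => simpa using HasValue.zero
  | insert a s ha ih =>
    rw [Finset.sum_insert ha, Finset.sum_insert ha]
    exact (h a (Finset.mem_insert_self a s)).add
      (ih fun i hi => h i (Finset.mem_insert_of_mem hi))

theorem HasValue.prod {ι : Type*} (s : Finset ι) {z : ι → K} {c : ι → ℚ}
    (h : ∀ i ∈ s, HasValue (z i) (c i)) : HasValue (∏ i ∈ s, z i) (∏ i ∈ s, c i) := by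
  induction s using Finset.induction_on with
  | empty => simpa using HasValue.one
  | insert a s ha ih =>
    rw [Finset.prod_insert ha, Finset.prod_insert ha]
    exact (h a (Finset.mem_insert_self a s)).mul
      (ih fun i hi => h i (Finset.mem_insert_of_mem hi))

theorem HasValue.ite {p : Prop} [Decidable p] {z w : K} {c d : ℚ} (hz : p → HasValue z c)
    (hw : ¬p → HasValue w d) : HasValue (if p then z else w) (if p then c else d) := by
  by_cases h : p
  · simpa [h] using hz h
  · simpa [h] using hw h

variable {I : Type*} [Fintype I]

/-- The matrix `X` over `ℚ(q)` is regular at `q = 1` and specializes to `x`. -/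
def Specializes (X : Matrix I I K) (x : Matrix I I ℚ) : Prop := ∀ i j, HasValue (X i j) (x i j)

theorem exists_common_denominator {X : Matrix I I K} {x : Matrix I I ℚ} (h : Specializes X x) :
    ∃ (d : ℚ[X]) (P : Matrix I I ℚ[X]), d ≠ 0 ∧
      P.map (algebraMap ℚ[X] K) = algebraMap ℚ[X] K d • X ∧ P.map (eval 1) = x := by
  choose d P hd hP hx using h
  refine ⟨∏ ij : I × I, d ij.1 ij.2, Matrix.of fun i j =>
    (∏ ij ∈ Finset.univ.erase (i, j), d ij.1 ij.2) * P i j, ?_, ?_, ?_⟩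
  · intro h0
    have := congrArg (eval 1) h0
    simp [eval_prod, hd] at this
  · ext i j
    simp only [Matrix.map_apply, Matrix.of_apply, Matrix.smul_apply, smul_eq_mul, map_mul,
      ← hP i j]
    rw [← Finset.mul_prod_erase Finset.univ (fun ij : I × I => d ij.1 ij.2)
      (Finset.mem_univ (i, j)), map_mul]
    ring
  · ext i j
    simp [eval_prod, hd, hx]

end Specialization

end IotaSchur

namespace IotaSchur

open Polynomial Matrix

section SpecializedAlgebra

variable {I A : Type*} [Fintype I] [DecidableEq I] [Ring A] [Algebra K A] (Ψ : A ≃ₐ[K] Matrix I I K)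

/-- The element of `A` with prescribed polynomial matrix entries. -/
def integral : Matrix I I ℚ[X] →+* A :=
  (Ψ.symm : Matrix I I K →+* A).comp (algebraMap ℚ[X] K).mapMatrix

theorem apply_integral (P : Matrix I I ℚ[X]) :
    Ψ (integral Ψ P) = P.map (algebraMap ℚ[X] K) := by
  simp [integral]

theorem integral_injective : Function.Injective (integral Ψ) := by
  intro P Q h
  have h1 := congrArg Ψ h
  rw [apply_integral, apply_integral] at h1
  exact Matrix.map_injective (IsFractionRing.injective ℚ[X] K) h1

theorem integral_smul (d : ℚ[X]) (P : Matrix I I ℚ[X]) :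
    integral Ψ (d • P) = algebraMap ℚ[X] K d • integral Ψ P := by
  apply Ψ.injective
  rw [map_smul Ψ, apply_integral, apply_integral]
  ext i j
  simp

/-- The algebra of values at `q = 1` of the elements of `U` with polynomial matrix entries. -/
def specialize (U : Subalgebra K A) : Subalgebra ℚ (Matrix I I ℚ) where
  carrier := {x | ∃ P, integral Ψ P ∈ U ∧ P.map (eval 1) = x}
  mul_mem' := by
    rintro _ _ ⟨P, hP, rfl⟩ ⟨Q, hQ, rfl⟩
    exact ⟨P * Q, by rw [map_mul]; exact U.mul_mem hP hQ,
      Matrix.map_mul (f := evalRingHom (1 : ℚ))⟩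
  add_mem' := by
    rintro _ _ ⟨P, hP, rfl⟩ ⟨Q, hQ, rfl⟩
    exact ⟨P + Q, by rw [map_add]; exact U.add_mem hP hQ, by ext; simp⟩
  algebraMap_mem' r := by
    refine ⟨(C r : ℚ[X]) • 1, ?_, ?_⟩
    · rw [integral_smul, map_one]; exact U.smul_mem U.one_mem _
    · ext i j
      by_cases h : i = j <;> simp [h, Matrix.algebraMap_matrix_apply]

variable {Ψ}

theorem mem_specialize_of_specializes {U : Subalgebra K A} {a : A} (ha : a ∈ U)
    {x : Matrix I I ℚ} (h : Specializes (Ψ a) x) : x ∈ specialize Ψ U := by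
  obtain ⟨d, P, -, hP, hx⟩ := exists_common_denominator h
  refine ⟨P, ?_, hx⟩
  have : integral Ψ P = algebraMap ℚ[X] K d • a := by
    apply Ψ.injective
    rw [apply_integral, hP, map_smul]
  rw [this]
  exact U.smul_mem ha _

theorem commute_of_mem_specialize {U : Subalgebra K A} {x y : Matrix I I ℚ}
    (hx : x ∈ specialize Ψ (Subalgebra.centralizer K (U : Set A))) (hy : y ∈ specialize Ψ U) :
    x * y = y * x := by
  obtain ⟨P, hP, rfl⟩ := hx
  obtain ⟨Q, hQ, rfl⟩ := hy
  have h1 : P * Q = Q * P := by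
    apply integral_injective Ψ
    rw [map_mul, map_mul]
    exact ((Subalgebra.mem_centralizer_iff K).1 hP _ hQ).symm
  have h2 := congrArg (evalRingHom (1 : ℚ)).mapMatrix h1
  rwa [map_mul, map_mul] at h2

theorem eq_of_specialize_le {S T : Subalgebra K A} (hST : S ≤ T)
    (h : specialize Ψ T ≤ specialize Ψ S) : S = T := by
  refine Subalgebra.toSubmodule_injective
    (eq_of_le_of_congruent (integral Ψ).toAddMonoidHom (integral_smul Ψ) ?_
      (fun x hx => hST hx) ?_)
  · intro a
    obtain ⟨⟨d, hd⟩, hP⟩ := IsLocalization.exist_integer_multiples_of_finite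
      (nonZeroDivisors ℚ[X]) (fun ij : I × I => Ψ a ij.1 ij.2)
    choose P hP using hP
    refine ⟨d, nonZeroDivisors.ne_zero hd, Matrix.of fun i j => P (i, j), ?_⟩
    apply Ψ.injective
    change Ψ (integral Ψ _) = _
    rw [apply_integral, map_smul]
    ext i j
    simpa [Algebra.smul_def] using hP (i, j)
  · intro P hP
    obtain ⟨P', hP', hev⟩ := h ⟨P, hP, rfl⟩
    refine ⟨P', hP', ?_⟩
    have : ∀ i j, ∃ z : ℚ[X], P i j - P' i j = (X - 1) * z := by
      intro i j
      have h1 := congrFun (congrFun hev i) j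
      simp only [Matrix.map_apply] at h1
      have h2 : (X - C 1 : ℚ[X]) ∣ P i j - P' i j := by
        rw [dvd_iff_isRoot, IsRoot.def, eval_sub, h1, sub_self]
      exact h2
    choose Z hZ using this
    exact ⟨Matrix.of Z, Matrix.ext hZ⟩

/-- Double centralizer property by specialization at `q = 1`: commuting subalgebras centralize
each other as soon as their specializations contain mutual centralizers, one of which is generated
by symmetric matrices. -/
theorem centralizer_eq_of_specialize {S T : Subalgebra K A}
    (hcomm : ∀ s ∈ S, ∀ t ∈ T, s * t = t * s) (G : Set (Matrix I I ℚ))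
    (hG : ∀ g ∈ G, gᵀ = g) (hGT : ∀ g ∈ G, g ∈ specialize Ψ T)
    (hS : ∀ x, (∀ g ∈ G, x * g = g * x) → x ∈ specialize Ψ S) :
    Subalgebra.centralizer K (S : Set A) = T ∧ Subalgebra.centralizer K (T : Set A) = S := by
  have hle : Algebra.adjoin ℚ G ≤ specialize Ψ T := Algebra.adjoin_le hGT
  have htr : ∀ h ∈ Algebra.adjoin ℚ G, hᵀ ∈ Algebra.adjoin ℚ G := by
    intro h hh
    induction hh using Algebra.adjoin_induction with
    | mem x hx => rw [hG x hx]; exact Algebra.subset_adjoin hx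
    | algebraMap r =>
      rw [Matrix.algebraMap_eq_diagonal, Matrix.diagonal_transpose,
        ← Matrix.algebraMap_eq_diagonal]
      exact Subalgebra.algebraMap_mem _ r
    | add x y _ _ hx hy => rw [Matrix.transpose_add]; exact add_mem hx hy
    | mul x y _ _ hx hy => rw [Matrix.transpose_mul]; exact mul_mem hy hx
  constructor
  · refine (eq_of_specialize_le (Ψ := Ψ) (fun t ht =>
      (Subalgebra.mem_centralizer_iff K).2 fun s hs => hcomm s hs t ht) fun x hx => hle ?_).symm
    refine mem_of_commutes_centralizer _ htr fun y hy => ?_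
    exact commute_of_mem_specialize hx (hS y fun g hg => hy g (Algebra.subset_adjoin hg))
  · refine (eq_of_specialize_le (Ψ := Ψ) (fun s hs =>
      (Subalgebra.mem_centralizer_iff K).2 fun t ht => (hcomm s hs t ht).symm)
      fun x hx => hS x fun g hg => ?_).symm
    exact commute_of_mem_specialize hx (hGT g hg)

end SpecializedAlgebra

end IotaSchur

namespace IotaSchur

section Tensor

variable {ι S F : Type*} [Fintype ι] [DecidableEq ι] [Fintype S] [DecidableEq S] [CommRing F]

/-- The tensor product of the matrices `A r`, indexed by tuples. -/
def tens : (ι → Matrix S S F) →* Matrix (ι → S) (ι → S) F where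
  toFun A := Matrix.of fun k l => ∏ r, A r (k r) (l r)
  map_one' := by
    ext k l
    simp only [Pi.one_apply, Matrix.of_apply, Matrix.one_apply]
    rw [Finset.prod_ite_zero]
    simp [funext_iff]
  map_mul' A B := by
    ext k l
    simp only [Pi.mul_apply, Matrix.of_apply, Matrix.mul_apply]
    rw [Finset.prod_univ_sum, Fintype.piFinset_univ]
    exact Finset.sum_congr rfl fun _ _ => Finset.prod_mul_distrib

theorem tens_apply (A : ι → Matrix S S F) (k l : ι → S) :
    tens A k l = ∏ r, A r (k r) (l r) := rfl

theorem tens_mulSingle_apply (r : ι) (x : Matrix S S F) (k l : ι → S) :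
    tens (Pi.mulSingle r x) k l =
      x (k r) (l r) * ∏ s ∈ Finset.univ.erase r, (1 : Matrix S S F) (k s) (l s) := by
  rw [tens_apply, ← Finset.mul_prod_erase _ _ (Finset.mem_univ r), Pi.mulSingle_eq_same]
  congr 1
  exact Finset.prod_congr rfl fun s hs => by rw [Pi.mulSingle_eq_of_ne (Finset.ne_of_mem_erase hs)]

/-- The diagonal action `x ↦ ∑ r, 1 ⊗ ⋯ ⊗ x ⊗ ⋯ ⊗ 1`. -/
def diagAction : Matrix S S F →ₗ[F] Matrix (ι → S) (ι → S) F where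
  toFun x := ∑ r, tens (Pi.mulSingle r x)
  map_add' x y := by
    ext k l
    simp only [Matrix.sum_apply, Matrix.add_apply, tens_mulSingle_apply, ← Finset.sum_add_distrib,
      add_mul]
  map_smul' c x := by
    ext k l
    simp only [Matrix.sum_apply, Matrix.smul_apply, tens_mulSingle_apply, Finset.mul_sum,
      smul_eq_mul, mul_assoc, RingHom.id_apply]

theorem diagAction_apply (x : Matrix S S F) :
    diagAction x = ∑ r : ι, tens (Pi.mulSingle r x) := rfl

theorem diagAction_commutator (x y : Matrix S S F) :
    (diagAction x * diagAction y - diagAction y * diagAction x : Matrix (ι → S) (ι → S) F) =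
      diagAction (x * y - y * x) := by
  rw [map_sub]
  simp only [diagAction_apply]
  rw [Finset.sum_mul_sum, Finset.sum_mul_sum, Finset.sum_comm (γ := ι), ← Finset.sum_sub_distrib,
    ← Finset.sum_sub_distrib]
  refine Finset.sum_congr rfl fun r _ => ?_
  rw [← Finset.sum_sub_distrib, Finset.sum_eq_single r]
  · simp only [← map_mul, Pi.mulSingle_mul]
  · intro s _ hs
    rw [← map_mul, ← map_mul, (Pi.mulSingle_commute (f := fun _ : ι => Matrix S S F) hs x y).eq,
      sub_self]
  · simp

/-- The symmetrization of `y₁ ⊗ ⋯ ⊗ yₙ`. -/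
def symTens (y : ι → Matrix S S F) : Matrix (ι → S) (ι → S) F :=
  ∑ w : Equiv.Perm ι, tens fun r => y (w r)

theorem symTens_comp_perm (y : ι → Matrix S S F) (v : Equiv.Perm ι) :
    symTens (fun r => y (v r)) = symTens y :=
  Fintype.sum_equiv (Equiv.mulLeft v) _ _ fun _ => rfl

theorem diagAction_mul_symTens (x : Matrix S S F) (y : ι → Matrix S S F) :
    diagAction x * symTens y = ∑ t, symTens (Function.update y t (x * y t)) := by
  simp only [symTens, diagAction_apply]
  rw [Finset.mul_sum, Finset.sum_comm]
  refine Finset.sum_congr rfl fun w _ => ?_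
  rw [Finset.sum_mul]
  refine Fintype.sum_equiv w _ _ fun s => ?_
  rw [← map_mul]
  congr 1
  funext r
  by_cases h : r = s
  · subst h; simp
  · simp [h]

/-- Symmetric tensors over an algebra `C` of matrices lie in every algebra containing the diagonal
action of `C`. -/
theorem symTens_mem [Algebra ℚ F] (C : Subalgebra ℚ (Matrix S S F))
    (B : Subalgebra ℚ (Matrix (ι → S) (ι → S) F)) (h : ∀ x ∈ C, diagAction x ∈ B)
    (y : ι → Matrix S S F) (hy : ∀ r, y r ∈ C) : symTens y ∈ B := by
  induction hk : (Finset.univ.filter fun r => y r ≠ 1).card using Nat.strong_induction_on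
    generalizing y with
  | _ k ih =>
  by_cases hy1 : ∀ r, y r = 1
  · have : y = 1 := funext hy1
    subst this
    refine sum_mem fun w _ => ?_
    change tens 1 ∈ B
    rw [map_one]; exact B.one_mem
  · push Not at hy1
    obtain ⟨r₀, hr₀⟩ := hy1
    set y' := Function.update y r₀ 1 with hy'
    have hy'C : ∀ r, y' r ∈ C := by
      intro r
      by_cases hr : r = r₀
      · subst hr; simp [hy', C.one_mem]
      · simp [hy', hr, hy]
    have hcard : (Finset.univ.filter fun r => y' r ≠ 1).card < k := by
      rw [← hk]
      refine Finset.card_lt_card ((Finset.ssubset_iff_of_subset ?_).2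
        ⟨r₀, by simpa using hr₀, by simp [hy']⟩)
      intro r
      by_cases hr : r = r₀
      · subst hr; simp [hy']
      · simp [hy', hr]
    have hB : diagAction (y r₀) * symTens y' ∈ B :=
      B.mul_mem (h _ (hy r₀)) (ih _ hcard y' hy'C rfl)
    rw [diagAction_mul_symTens, ← Finset.sum_filter_add_sum_filter_not _ fun t => y' t = 1] at hB
    have h1 : ∀ t ∈ Finset.univ.filter (fun t => y' t = 1),
        symTens (Function.update y' t (y r₀ * y' t)) = symTens y := by
      intro t ht
      have ht' : y' t = 1 := by simpa using ht
      rw [← symTens_comp_perm y (Equiv.swap t r₀)]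
      congr 1
      funext r
      by_cases hr : r = t
      · subst hr; simp [ht']
      · by_cases hr' : r = r₀
        · subst hr'
          by_cases htr : t = r
          · exact absurd htr.symm hr
          · have : y t = 1 := by simpa [hy', htr] using ht'
            simp [hr, hy', this]
        · simp [hr, hr', hy', Equiv.swap_apply_of_ne_of_ne]
    have h2 : (∑ t ∈ Finset.univ.filter (fun t => ¬ y' t = 1),
        symTens (Function.update y' t (y r₀ * y' t))) ∈ B := by
      refine sum_mem fun t ht => ih _ (lt_of_le_of_lt (Finset.card_le_card ?_) hcard) _ ?_ rfl
      · intro r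
        by_cases hr : r = t
        · subst hr; simpa using fun _ => ht
        · simp [hr]
      · intro r
        by_cases hr : r = t
        · subst hr; simpa using C.mul_mem (hy r₀) (hy'C r)
        · simpa [hr] using hy'C r
    have h3 := B.sub_mem hB h2
    rw [add_sub_cancel_right, Finset.sum_congr rfl h1, Finset.sum_const,
      ← Nat.cast_smul_eq_nsmul ℚ] at h3
    have h4 : ((Finset.univ.filter fun t => y' t = 1).card : ℚ) ≠ 0 := by
      rw [Nat.cast_ne_zero, Finset.card_ne_zero]
      exact ⟨r₀, by simp [hy']⟩
    exact ((Subalgebra.toSubmodule B).smul_mem_iff h4).1 h3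

end Tensor

section SignedUnits

variable {S : Type*} [DecidableEq S] (ν : S → S)

/-- The matrix `e_{ab} + e_{ν a, ν b}`. -/
def signedUnit (F : Type*) [CommRing F] (a b : S) : Matrix S S F :=
  Matrix.single a b 1 + Matrix.single (ν a) (ν b) 1

variable {ν}

theorem signedUnit_neg {F : Type*} [CommRing F] (hν : Function.Involutive ν) (a b : S) :
    signedUnit ν F (ν a) (ν b) = signedUnit ν F a b := by
  rw [signedUnit, signedUnit, hν, hν, add_comm]

theorem signedUnit_mul [Fintype S] {F : Type*} [CommRing F] (hν : Function.Involutive ν) (a b c d : S) :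
    signedUnit ν F a b * signedUnit ν F c d = (if b = c then signedUnit ν F a d else 0)
      + (if b = ν c then signedUnit ν F a (ν d) else 0) := by
  have h1 : (ν b = ν c) ↔ b = c := hν.injective.eq_iff
  have h2 : (ν b = c) ↔ b = ν c := ⟨fun h => by rw [← h, hν], fun h => by rw [h, hν]⟩
  have key : ∀ i j k l : S, (Matrix.single i j 1 * Matrix.single k l 1 : Matrix S S F)
      = if j = k then Matrix.single i l 1 else 0 := by
    intro i j k l
    split_ifs with h
    · subst h; simp
    · exact Matrix.single_mul_single_of_ne _ _ _ _ h _
  simp only [signedUnit, add_mul, mul_add, key, h1, h2, hν d]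
  split_ifs <;> abel

/-- A relation on `{0, …, 2m - 1}` containing the diagonal and the first subdiagonal and compatible
with the commutators of signed matrix units is total. -/
theorem relation_of_commutators {m : ℕ} (P : ℕ → ℕ → Prop)
    (hrev : ∀ a b, a < 2 * m → b < 2 * m → P a b → P (2 * m - 1 - a) (2 * m - 1 - b))
    (hdiag : ∀ a < 2 * m, P a a) (hstep : ∀ a, a + 1 < 2 * m → P (a + 1) a)
    (hbr : ∀ a b c, a < 2 * m → b < 2 * m → c < 2 * m → c ≠ a → c ≠ 2 * m - 1 - a →
      P a b → P b c → P a c)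
    (hanti : ∀ a b, a < 2 * m → b < 2 * m → P a b → P b (2 * m - 1 - a) →
      P b (2 * m - 1 - b) → P a (2 * m - 1 - a)) :
    ∀ a b, a < 2 * m → b < 2 * m → P a b := by
  have h1 : ∀ k < m, P (m + k) (2 * m - 1 - (m + k)) := by
    intro k
    induction k with
    | zero =>
      intro hk
      have := hstep (m - 1) (by omega)
      convert this using 1 <;> omega
    | succ k ih =>
      intro hk
      have ih := ih (by omega)
      have h2 := hstep (m + k) (by omega)
      refine hanti (m + (k + 1)) (m + k) (by omega) (by omega) h2 ?_ ih
      refine hbr _ (2 * m - 1 - (m + k)) _ (by omega) (by omega) (by omega) (by omega) (by omega)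
        ih ?_
      have h3 := hstep (2 * m - 1 - (m + (k + 1))) (by omega)
      convert h3 using 1; omega
  have h2 : ∀ a < 2 * m, P a (2 * m - 1 - a) := by
    intro a ha
    by_cases h : m ≤ a
    · have := h1 (a - m) (by omega)
      rwa [Nat.add_sub_cancel' h] at this
    · have := hrev _ _ (by omega) (by omega) (h1 (m - 1 - a) (by omega))
      convert this using 1 <;> omega
  have h3 : ∀ b k, b + k < 2 * m → P (b + k) b := by
    intro b k
    induction k with
    | zero => exact fun h => hdiag _ h
    | succ k ih =>
      intro hk
      by_cases hb : b = 2 * m - 1 - (b + (k + 1))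
      · have := h2 (b + (k + 1)) hk
        rwa [← hb] at this
      · exact hbr _ _ _ hk (by omega) (by omega) (by omega) hb (hstep (b + k) (by omega))
          (ih (by omega))
  intro a b ha hb
  by_cases h : b ≤ a
  · have := h3 b (a - b) (by omega)
    rwa [Nat.add_sub_cancel' h] at this
  · have := hrev _ _ (by omega) (by omega) (h3 (2 * m - 1 - b) (b - a) (by omega))
    convert this using 1 <;> omega

variable [Fintype S]

/-- The matrices commuting with the involution `ν`. -/
def evenMatrices (hν : Function.Involutive ν) : Subalgebra ℚ (Matrix S S ℚ) where
  carrier := {x | ∀ s t, x (ν s) (ν t) = x s t}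
  mul_mem' := by
    intro x y hx hy s t
    simp only [Matrix.mul_apply]
    rw [← Equiv.sum_comp hν.toPerm]
    exact Finset.sum_congr rfl fun r _ => by rw [hν.coe_toPerm, hx, hy]
  add_mem' := by
    intro x y hx hy s t
    simp [hx s t, hy s t]
  algebraMap_mem' r := by
    intro s t
    simp [Matrix.algebraMap_matrix_apply, hν.injective.eq_iff]

theorem signedUnit_mem_evenMatrices (hν : Function.Involutive ν) (a b : S) :
    signedUnit ν ℚ a b ∈ evenMatrices hν := by
  intro s t
  have h2 : ∀ a b, (ν a = b) ↔ a = ν b :=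
    fun a b => ⟨fun h => by rw [← h, hν], fun h => by rw [h, hν]⟩
  simp only [signedUnit, Matrix.add_apply, Matrix.single_apply, h2, hν s, hν t]
  exact add_comm _ _

theorem mem_of_signedUnit_mem (hν : Function.Involutive ν) (g : Submodule ℚ (Matrix S S ℚ))
    (hg : ∀ a b, signedUnit ν ℚ a b ∈ g) {x : Matrix S S ℚ} (hx : x ∈ evenMatrices hν) :
    x ∈ g := by
  have h1 : (2 : ℚ) • x = ∑ a, ∑ b, x a b • signedUnit ν ℚ a b := by
    have h2 : ∑ a, ∑ b, x a b • Matrix.single (ν a) (ν b) (1 : ℚ) = x := by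
      conv_rhs => rw [Matrix.matrix_eq_sum_single x]
      rw [← Equiv.sum_comp hν.toPerm]
      refine Finset.sum_congr rfl fun a _ => ?_
      rw [← Equiv.sum_comp hν.toPerm]
      refine Finset.sum_congr rfl fun b _ => ?_
      simp only [hν.coe_toPerm, hν a, hν b, hx a b]
      simp
    have h3 : ∑ a, ∑ b, x a b • Matrix.single a b (1 : ℚ) = x := by
      conv_rhs => rw [Matrix.matrix_eq_sum_single x]
      simp
    simp only [signedUnit, smul_add, Finset.sum_add_distrib]
    rw [h2, h3, two_smul]
  rw [← g.smul_mem_iff (two_ne_zero : (2 : ℚ) ≠ 0), h1]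
  exact sum_mem fun a _ => sum_mem fun b _ => g.smul_mem _ (hg a b)

/-- The matrices commuting with a fixed-point-free involution are generated, as a Lie algebra, by
signed matrix units on and next to the diagonal. -/
theorem evenMatrices_le_of_commutator_mem {m : ℕ} (f : ℕ → S)
    (hf : ∀ s, ∃ k < 2 * m, f k = s) (hinj : ∀ a < 2 * m, ∀ b < 2 * m, f a = f b → a = b)
    (hν : Function.Involutive ν) (hrev : ∀ k < 2 * m, ν (f k) = f (2 * m - 1 - k))
    (g : Submodule ℚ (Matrix S S ℚ)) (hbr : ∀ x ∈ g, ∀ y ∈ g, x * y - y * x ∈ g)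
    (hdiag : ∀ k < 2 * m, signedUnit ν ℚ (f k) (f k) ∈ g)
    (hstep : ∀ k, k + 1 < 2 * m → signedUnit ν ℚ (f (k + 1)) (f k) ∈ g)
    {x : Matrix S S ℚ} (hx : x ∈ evenMatrices hν) : x ∈ g := by
  refine mem_of_signedUnit_mem hν g ?_ hx
  have hinj' : ∀ {a b}, a < 2 * m → b < 2 * m → (f a = f b ↔ a = b) :=
    fun ha hb => ⟨hinj _ ha _ hb, congrArg f⟩
  have key := relation_of_commutators (m := m) (fun a b => signedUnit ν ℚ (f a) (f b) ∈ g)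
    (fun a b ha hb h => by
      rwa [← hrev a ha, ← hrev b hb, signedUnit_neg hν]) hdiag hstep ?_ ?_
  · intro a b
    obtain ⟨i, hi, rfl⟩ := hf a
    obtain ⟨j, hj, rfl⟩ := hf b
    exact key i j hi hj
  · intro a b c ha hb hc h1 h2 hab hbc
    have h := hbr _ hab _ hbc
    rw [signedUnit_mul hν, signedUnit_mul hν, hrev b hb, hrev a ha, if_pos rfl,
      if_neg (by rw [hinj' hb (by omega)]; omega), if_neg (by rwa [hinj' hc ha]),
      if_neg (by rwa [hinj' hc (by omega)])] at h
    simpa using h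
  · intro a b ha hb hab hba hbb
    have h := hbr _ hab _ hba
    rw [signedUnit_mul hν, signedUnit_mul hν, hrev b hb, hrev a ha, if_pos rfl,
      if_neg (by rw [hinj' hb (by omega)]; omega),
      if_neg (by rw [hinj' (by omega) ha]; omega), if_pos rfl] at h
    have h3 := g.add_mem h hbb
    simpa using h3

end SignedUnits

end IotaSchur

namespace IotaSchur

section Hecke

variable {J F : Type*} [DecidableEq J] [CommRing F]

/-- The operator `v_l ↦ v_{p l} + w l • v_l`. -/
def heckeMatrix (p : J → J) (w : J → F) : Matrix J J F :=
  Matrix.of fun k l => (if k = p l then 1 else 0) + (if k = l then w l else 0)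

theorem heckeMatrix_transpose {p : J → J} (hp : Function.Involutive p) (w : J → F) :
    (heckeMatrix p w).transpose = heckeMatrix p w := by
  ext k l
  have h : l = p k ↔ k = p l := ⟨fun h => by rw [h, hp], fun h => by rw [h, hp]⟩
  have h' : (if l = k then w k else 0) = if k = l then w l else 0 := by
    by_cases hkl : k = l
    · simp [hkl]
    · simp [hkl, Ne.symm hkl]
  simp only [heckeMatrix, Matrix.transpose_apply, Matrix.of_apply, h, h']

variable [Fintype J]

theorem heckeMatrix_mul_apply {p : J → J} (hp : Function.Involutive p) (w : J → F)
    (X : Matrix J J F) (k l : J) : (heckeMatrix p w * X) k l = X (p k) l + w k * X k l := by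
  have h : ∀ j, k = p j ↔ j = p k :=
    fun j => ⟨fun h => by rw [h, hp], fun h => by rw [h, hp]⟩
  simp [Matrix.mul_apply, heckeMatrix, add_mul, Finset.sum_add_distrib, h]

theorem mul_heckeMatrix_apply (p : J → J) (w : J → F)
    (X : Matrix J J F) (k l : J) : (X * heckeMatrix p w) k l = X k (p l) + X k l * w l := by
  simp [Matrix.mul_apply, heckeMatrix, mul_add, Finset.sum_add_distrib]

end Hecke

section Invariants

variable {ι S : Type*} {ν : S → S}

/-- The action on tuples of the signs `β` and the permutation `w`. -/
def signedPerm (ν : S → S) (w : Equiv.Perm ι) (β : ι → Bool) (k : ι → S) : ι → S :=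
  fun r => if β r then ν (k (w r)) else k (w r)

theorem signedPerm_injective (hν : Function.Involutive ν) (w : Equiv.Perm ι) (β : ι → Bool) :
    Function.Injective (signedPerm ν w β) := by
  intro k l h
  funext r
  have h1 := congrFun h (w.symm r)
  simp only [signedPerm, Equiv.apply_symm_apply] at h1
  split_ifs at h1
  · exact hν.injective h1
  · exact h1

variable [Fintype ι] [DecidableEq ι] [Fintype S] [DecidableEq S]

theorem tens_single {F : Type*} [CommRing F] (k l : ι → S) :
    tens (fun r => Matrix.single (k r) (l r) (1 : F)) = Matrix.single k l 1 := by
  ext i j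
  simp only [tens_apply, Matrix.single_apply]
  rw [Finset.prod_ite_zero]
  simp [funext_iff, forall_and]

theorem symTens_signedUnit {F : Type*} [CommRing F] (k l : ι → S) :
    symTens (fun r => signedUnit ν F (k r) (l r)) = ∑ w : Equiv.Perm ι, ∑ β : ι → Bool,
      Matrix.single (signedPerm ν w β k) (signedPerm ν w β l) 1 := by
  refine Finset.sum_congr rfl fun w _ => ?_
  simp only [← tens_single]
  ext i j
  simp only [tens_apply, Matrix.sum_apply]
  have h := Finset.prod_univ_sum (fun _ => Finset.univ) fun r (b : Bool) =>
    Matrix.single (if b then ν (k (w r)) else k (w r)) (if b then ν (l (w r)) else l (w r))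
      (1 : F) (i r) (j r)
  rw [Fintype.piFinset_univ] at h
  refine Eq.trans (Finset.prod_congr rfl fun r _ => ?_) h
  simp [signedUnit, add_comm]

/-- A matrix invariant under signed permutations is a combination of symmetric tensors. -/
theorem smul_eq_sum_symTens (hν : Function.Involutive ν) {X : Matrix (ι → S) (ι → S) ℚ}
    (hX : ∀ w β k l, X (signedPerm ν w β k) (signedPerm ν w β l) = X k l) :
    (Fintype.card (Equiv.Perm ι) * Fintype.card (ι → Bool) : ℚ) • X =
      ∑ k, ∑ l, X k l • symTens (fun r => signedUnit ν ℚ (k r) (l r)) := by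
  have h1 : ∀ w β, ∑ k, ∑ l, X k l •
      Matrix.single (signedPerm ν w β k) (signedPerm ν w β l) (1 : ℚ) = X := by
    intro w β
    have hb := Finite.injective_iff_bijective.1 (signedPerm_injective hν w β)
    conv_rhs => rw [Matrix.matrix_eq_sum_single X]
    rw [← hb.sum_comp fun k => ∑ l, Matrix.single k l (X k l)]
    refine Finset.sum_congr rfl fun k _ => ?_
    rw [← hb.sum_comp fun l => Matrix.single _ l (X _ l)]
    refine Finset.sum_congr rfl fun l _ => ?_
    rw [hX]; simp
  have h2 : ∀ k l, X k l • symTens (fun r => signedUnit ν ℚ (k r) (l r)) =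
      ∑ w : Equiv.Perm ι, ∑ β : ι → Bool,
        X k l • Matrix.single (signedPerm ν w β k) (signedPerm ν w β l) (1 : ℚ) := by
    intro k l
    simp only [symTens_signedUnit, Finset.smul_sum]
  simp only [h2]
  calc _ = ∑ w : Equiv.Perm ι, ∑ β : ι → Bool, X := by
        simp only [Finset.sum_const, Finset.card_univ, ← Nat.cast_smul_eq_nsmul ℚ, smul_smul]
    _ = ∑ w : Equiv.Perm ι, ∑ β : ι → Bool, ∑ k, ∑ l, X k l •
      Matrix.single (signedPerm ν w β k) (signedPerm ν w β l) (1 : ℚ) := by simp only [h1]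
    _ = _ := by
      simp only [← Fintype.sum_prod_type']
      refine Fintype.sum_equiv ⟨fun x => (x.2.2.1, x.2.2.2, x.1, x.2.1),
        fun x => (x.2.2.1, x.2.2.2, x.1, x.2.1), fun _ => rfl, fun _ => rfl⟩ _ _ fun _ => rfl

end Invariants

section Generators

variable {S : Type*} {ν : S → S} {n : ℕ}

/-- Negation of the entry of a tuple at `r`. -/
def flipAt (ν : S → S) (r : Fin n) (k : Fin n → S) : Fin n → S := Function.update k r (ν (k r))

theorem flipAt_involutive (hν : Function.Involutive ν) (r : Fin n) :
    Function.Involutive (flipAt ν r) := by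
  intro k
  simp [flipAt, hν (k r)]

theorem swap_involutive (a b : Fin n) :
    Function.Involutive fun k : Fin n → S => k ∘ Equiv.swap a b := by
  intro k
  funext r
  simp

/-- Invariance under adjacent transpositions and one sign change implies invariance under all
signed permutations. -/
theorem signedPerm_invariant (hn : 0 < n) {X : Matrix (Fin n → S) (Fin n → S) ℚ}
    (hflip : ∀ k l, X (flipAt ν ⟨0, hn⟩ k) (flipAt ν ⟨0, hn⟩ l) = X k l)
    (hswap : ∀ a b : Fin n, a.val + 1 = b.val → ∀ k l,
      X (k ∘ Equiv.swap a b) (l ∘ Equiv.swap a b) = X k l)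
    (w : Equiv.Perm (Fin n)) (β : Fin n → Bool) (k l : Fin n → S) :
    X (signedPerm ν w β k) (signedPerm ν w β l) = X k l := by
  have hperm : ∀ (w : Equiv.Perm (Fin n)) (k l : Fin n → S), X (k ∘ w) (l ∘ w) = X k l := by
    obtain ⟨N, rfl⟩ : ∃ N, n = N + 1 := ⟨n - 1, by omega⟩
    intro w
    have hw : w ∈ Submonoid.closure (Set.range fun i : Fin N ↦ Equiv.swap i.castSucc i.succ) := by
      rw [Equiv.Perm.mclosure_swap_castSucc_succ]; trivial
    induction hw using Submonoid.closure_induction with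
    | mem x hx =>
      obtain ⟨i, rfl⟩ := hx
      exact hswap _ _ (by simp)
    | one => exact fun _ _ => rfl
    | mul x y _ _ hx hy =>
      intro k l
      rw [Equiv.Perm.coe_mul, ← Function.comp_assoc, ← Function.comp_assoc, hy, hx]
  have hflips : ∀ r k l, X (flipAt ν r k) (flipAt ν r l) = X k l := by
    intro r k l
    have h1 : ∀ k : Fin n → S, flipAt ν r k =
        flipAt ν ⟨0, hn⟩ (k ∘ Equiv.swap ⟨0, hn⟩ r) ∘ Equiv.swap ⟨0, hn⟩ r := by
      intro k
      funext s
      by_cases hs : s = r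
      · subst hs; simp [flipAt]
      · by_cases hs0 : s = ⟨0, hn⟩
        · subst hs0; simp [flipAt, hs, Ne.symm hs]
        · simp [flipAt, hs, hs0, Equiv.swap_apply_of_ne_of_ne]
    rw [h1 k, h1 l, hperm, hflip, hperm]
  have hset : ∀ t : Finset (Fin n), ∀ k l : Fin n → S,
      X (fun r => if r ∈ t then ν (k r) else k r) (fun r => if r ∈ t then ν (l r) else l r)
        = X k l := by
    intro t
    induction t using Finset.induction_on with
    | empty => simp
    | insert a t ha ih =>
      intro k l
      have h1 : ∀ k : Fin n → S, (fun r => if r ∈ insert a t then ν (k r) else k r) =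
          flipAt ν a fun r => if r ∈ t then ν (k r) else k r := by
        intro k
        funext r
        by_cases hr : r = a
        · subst hr; simp [flipAt, ha]
        · simp [flipAt, hr]
      rw [h1, h1, hflips, ih]
  have h1 : ∀ k, signedPerm ν w β k =
      fun r => if r ∈ Finset.univ.filter (fun r => β r = true) then ν ((k ∘ w) r) else (k ∘ w) r :=
    fun k => by funext r; simp [signedPerm]
  rw [h1, h1, hset, hperm]

variable [Fintype S] [DecidableEq S]

theorem apply_of_commute_heckeMatrix {J : Type*} [Fintype J] [DecidableEq J] {p : J → J}
    (hp : Function.Involutive p) {X : Matrix J J ℚ}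
    (h : X * heckeMatrix p 0 = heckeMatrix p 0 * X) (k l : J) : X (p k) (p l) = X k l := by
  have h1 := congrFun (congrFun h k) (p l)
  rw [heckeMatrix_mul_apply hp, mul_heckeMatrix_apply, hp] at h1
  simpa using h1.symm

/-- The signed permutation matrices of the Coxeter generators. -/
def coxeterMatrices (ν : S → S) (hn : 0 < n) : Set (Matrix (Fin n → S) (Fin n → S) ℚ) :=
  {g | g = heckeMatrix (flipAt ν ⟨0, hn⟩) 0 ∨ ∃ a b : Fin n, a.val + 1 = b.val ∧
    g = heckeMatrix (fun k => k ∘ Equiv.swap a b) 0}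

/-- The commutant of the signed permutations lies in every algebra containing the diagonal actions
of signed matrix units on and next to the diagonal. -/
theorem mem_of_commutes_coxeterMatrices {m : ℕ} (hn : 0 < n) (f : ℕ → S)
    (hf : ∀ s, ∃ k < 2 * m, f k = s) (hinj : ∀ a < 2 * m, ∀ b < 2 * m, f a = f b → a = b)
    (hν : Function.Involutive ν) (hrev : ∀ k < 2 * m, ν (f k) = f (2 * m - 1 - k))
    (B : Subalgebra ℚ (Matrix (Fin n → S) (Fin n → S) ℚ))
    (hdiag : ∀ k < 2 * m, diagAction (signedUnit ν ℚ (f k) (f k)) ∈ B)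
    (hstep : ∀ k, k + 1 < 2 * m → diagAction (signedUnit ν ℚ (f (k + 1)) (f k)) ∈ B)
    {X : Matrix (Fin n → S) (Fin n → S) ℚ}
    (hX : ∀ g ∈ coxeterMatrices ν hn, X * g = g * X) : X ∈ B := by
  have hΔ : ∀ x ∈ evenMatrices hν, diagAction x ∈ B := fun x hx =>
    evenMatrices_le_of_commutator_mem f hf hinj hν hrev
      ((Subalgebra.toSubmodule B).comap diagAction)
      (fun x hx y hy => by
        change diagAction _ ∈ B
        rw [← diagAction_commutator]
        exact B.sub_mem (B.mul_mem hx hy) (B.mul_mem hy hx)) hdiag hstep hx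
  have h1 := smul_eq_sum_symTens hν (signedPerm_invariant (ν := ν) hn
    (apply_of_commute_heckeMatrix (flipAt_involutive hν _) (hX _ (Or.inl rfl)))
    (fun a b hab => apply_of_commute_heckeMatrix (swap_involutive a b)
      (hX _ (Or.inr ⟨a, b, hab, rfl⟩))))
  have h2 : (Fintype.card (Equiv.Perm (Fin n)) * Fintype.card (Fin n → Bool) : ℚ) ≠ 0 := by
    exact_mod_cast mul_ne_zero Fintype.card_ne_zero Fintype.card_ne_zero
  rw [← Subalgebra.mem_toSubmodule, ← Submodule.smul_mem_iff _ h2, h1]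
  exact sum_mem fun k _ => sum_mem fun l _ => Submodule.smul_mem _ _
    (symTens_mem _ B hΔ _ fun r => signedUnit_mem_evenMatrices hν _ _)

end Generators

end IotaSchur

namespace IotaSchur

section Locality

variable {J T F : Type*} [Fintype J] [DecidableEq J] [Fintype T] [DecidableEq T] [CommRing F]

theorem commute_heckeMatrix_iff {p : J → J} (hp : Function.Involutive p) {w : J → F}
    {X : Matrix J J F} : Commute (heckeMatrix p w) X ↔
      ∀ k l, X (p k) l + w k * X k l = X k (p l) + X k l * w l := by
  rw [commute_iff_eq, ← Matrix.ext_iff]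
  simp only [heckeMatrix_mul_apply hp, mul_heckeMatrix_apply]

theorem commute_heckeMatrix_diagonal {p : J → J} (hp : Function.Involutive p) (w : J → F)
    {d : J → F} (hd : ∀ k, d (p k) = d k) : Commute (heckeMatrix p w) (Matrix.diagonal d) := by
  rw [commute_heckeMatrix_iff hp]
  intro k l
  have h : p k = l ↔ k = p l := ⟨fun h => by rw [← h, hp], fun h => by rw [h, hp]⟩
  simp only [Matrix.diagonal_apply, h]
  by_cases h1 : k = l <;> by_cases h2 : k = p l <;> by_cases h3 : p l = l <;>
    simp_all [mul_comm]

/-- A matrix acting through the quotient `π` of the index set commutes with the lift of a Hecke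
operator of the quotient with which it commutes there. -/
theorem commute_heckeMatrix_lift {p : J → J} (hp : Function.Involutive p) {p' : T → T}
    (hp' : Function.Involutive p') {π : J → T} (hπ : ∀ k, π (p k) = p' (π k)) {w : T → F}
    {Y : Matrix T T F} (hY : Commute (heckeMatrix p' w) Y) {ρ : J → J → F}
    (hl : ∀ k l, ρ (p k) l = ρ k l) (hr : ∀ k l, ρ k (p l) = ρ k l) :
    Commute (heckeMatrix p fun k => w (π k)) (Matrix.of fun k l => Y (π k) (π l) * ρ k l) := by
  rw [commute_heckeMatrix_iff hp'] at hY
  rw [commute_heckeMatrix_iff hp]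
  intro k l
  simp only [Matrix.of_apply, hπ, hl, hr]
  linear_combination ρ k l * hY (π k) (π l)

end Locality

section TensorCommute

open scoped Kronecker

variable {n : ℕ} {S F : Type*} [Fintype S] [DecidableEq S] [CommRing F]

theorem commute_flip_of_apply_eq (hn : 0 < n) {ν : S → S} (hν : Function.Involutive ν) {w : S → F}
    {X : Matrix (Fin n → S) (Fin n → S) F} {Y : Matrix S S F} (hY : Commute (heckeMatrix ν w) Y)
    (R : Fin n → Matrix S S F)
    (hX : ∀ k l, X k l = Y (k ⟨0, hn⟩) (l ⟨0, hn⟩) *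
      ∏ s ∈ Finset.univ.erase ⟨0, hn⟩, R s (k s) (l s)) :
    Commute (heckeMatrix (flipAt ν ⟨0, hn⟩) fun k => w (k ⟨0, hn⟩)) X := by
  have h := commute_heckeMatrix_lift (flipAt_involutive hν ⟨0, hn⟩) hν
    (π := fun k : Fin n → S => k ⟨0, hn⟩) (fun k => by simp [flipAt]) hY
    (ρ := fun k l => ∏ s ∈ Finset.univ.erase ⟨0, hn⟩, R s (k s) (l s))
    (fun k l => Finset.prod_congr rfl fun s hs => by
      simp [flipAt, Finset.ne_of_mem_erase hs])
    (fun k l => Finset.prod_congr rfl fun s hs => by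
      simp [flipAt, Finset.ne_of_mem_erase hs])
  rwa [show X = _ from Matrix.ext hX]

theorem commute_swap_of_apply_eq {a b : Fin n} {w : S × S → F}
    {X : Matrix (Fin n → S) (Fin n → S) F} {Y : Matrix (S × S) (S × S) F}
    (hY : Commute (heckeMatrix Prod.swap w) Y) (R : Fin n → Matrix S S F)
    (hX : ∀ k l, X k l = Y (k a, k b) (l a, l b) *
      ∏ s ∈ (Finset.univ.erase a).erase b, R s (k s) (l s)) :
    Commute (heckeMatrix (fun k : Fin n → S => k ∘ Equiv.swap a b) fun k => w (k a, k b)) X := by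
  have hs : ∀ s ∈ (Finset.univ.erase a).erase b, Equiv.swap a b s = s := fun s hs =>
    Equiv.swap_apply_of_ne_of_ne (Finset.ne_of_mem_erase (Finset.mem_of_mem_erase hs))
      (Finset.ne_of_mem_erase hs)
  have h := commute_heckeMatrix_lift (swap_involutive a b) Prod.swap_swap
    (π := fun k : Fin n → S => (k a, k b)) (fun k => by simp) hY
    (ρ := fun k l => ∏ s ∈ (Finset.univ.erase a).erase b, R s (k s) (l s))
    (fun k l => Finset.prod_congr rfl fun s h => by simp [hs s h])
    (fun k l => Finset.prod_congr rfl fun s h => by simp [hs s h])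
  rwa [show X = _ from Matrix.ext hX]

theorem tens_apply_eq_mul_prod_erase (A : Fin n → Matrix S S F) (r : Fin n) (k l : Fin n → S) :
    tens A k l = A r (k r) (l r) * ∏ s ∈ Finset.univ.erase r, A s (k s) (l s) := by
  exact (Finset.mul_prod_erase _ (fun r => A r (k r) (l r)) (Finset.mem_univ r)).symm

theorem tens_apply_eq_kronecker_mul_prod_erase (A : Fin n → Matrix S S F) {a b : Fin n}
    (hab : a ≠ b) (k l : Fin n → S) :
    tens A k l = (A a ⊗ₖ A b) (k a, k b) (l a, l b) *
      ∏ s ∈ (Finset.univ.erase a).erase b, A s (k s) (l s) := by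
  rw [tens_apply_eq_mul_prod_erase A a, ← Finset.mul_prod_erase (Finset.univ.erase a) _
    (Finset.mem_erase.2 ⟨hab.symm, Finset.mem_univ b⟩), Matrix.kroneckerMap_apply, mul_assoc]

/-- The tensor `A ⊗ ⋯ ⊗ A ⊗ B ⊗ C ⊗ ⋯ ⊗ C` with `B` at `r`. -/
def skewTens (A B C : Matrix S S F) (r : Fin n) : Matrix (Fin n → S) (Fin n → S) F :=
  tens fun s => if s < r then A else if s = r then B else C

theorem commute_swap_tens {a b : Fin n} (hab : a ≠ b) {w : S × S → F} {A : Fin n → Matrix S S F}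
    (h : Commute (heckeMatrix Prod.swap w) (A a ⊗ₖ A b)) :
    Commute (heckeMatrix (fun k : Fin n → S => k ∘ Equiv.swap a b) fun k => w (k a, k b))
      (tens A) :=
  commute_swap_of_apply_eq h A (tens_apply_eq_kronecker_mul_prod_erase A hab)

theorem commute_flip_tens (hn : 0 < n) {ν : S → S} (hν : Function.Involutive ν) {w : S → F}
    {A : Fin n → Matrix S S F} (h : Commute (heckeMatrix ν w) (A ⟨0, hn⟩)) :
    Commute (heckeMatrix (flipAt ν ⟨0, hn⟩) fun k => w (k ⟨0, hn⟩)) (tens A) :=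
  commute_flip_of_apply_eq hn hν h A (tens_apply_eq_mul_prod_erase A _)

theorem commute_swap_sum_skewTens {a b : Fin n} (hab : a.val + 1 = b.val) {w : S × S → F}
    {A B C : Matrix S S F} (hA : Commute (heckeMatrix Prod.swap w) (A ⊗ₖ A))
    (hC : Commute (heckeMatrix Prod.swap w) (C ⊗ₖ C))
    (hB : Commute (heckeMatrix Prod.swap w) (B ⊗ₖ C + A ⊗ₖ B)) :
    Commute (heckeMatrix (fun k : Fin n → S => k ∘ Equiv.swap a b) fun k => w (k a, k b))
      (∑ r, skewTens A B C r) := by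
  have hne : a ≠ b := fun h => by rw [h] at hab; omega
  rw [← Finset.add_sum_erase _ _ (Finset.mem_univ a), ← Finset.add_sum_erase _ _
    (Finset.mem_erase.2 ⟨hne.symm, Finset.mem_univ b⟩), ← add_assoc]
  refine Commute.add_right ?_ (Commute.sum_right _ _ _ fun r hr => ?_)
  · refine commute_swap_of_apply_eq hB (fun s => if s < a then A else C) fun k l => ?_
    rw [Matrix.add_apply, Matrix.add_apply, skewTens, skewTens,
      tens_apply_eq_kronecker_mul_prod_erase _ hne, tens_apply_eq_kronecker_mul_prod_erase _ hne,
      add_mul]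
    have hba : ¬ b < a := by rw [Fin.lt_def]; omega
    have hlt : a < b := by rw [Fin.lt_def]; omega
    congr 2
    · simp [hba, hne.symm]
    · refine Finset.prod_congr rfl fun s hs => ?_
      simp [Finset.ne_of_mem_erase (Finset.mem_of_mem_erase hs)]
    · simp [hlt]
    · refine Finset.prod_congr rfl fun s hs => ?_
      have h1 := Finset.ne_of_mem_erase hs
      have h2 := Finset.ne_of_mem_erase (Finset.mem_of_mem_erase hs)
      have h3 : s < b ↔ s < a := by
        rw [Fin.lt_def, Fin.lt_def]
        have := Fin.val_ne_of_ne h2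
        omega
      simp [h1, h3]
  · have h1 := Fin.val_ne_of_ne (Finset.ne_of_mem_erase hr)
    have h2 := Fin.val_ne_of_ne (Finset.ne_of_mem_erase (Finset.mem_of_mem_erase hr))
    refine commute_swap_tens hne ?_
    by_cases h : a < r
    · have h3 : b < r := by rw [Fin.lt_def] at h ⊢; omega
      simpa [h, h3] using hA
    · have h3 : ¬ b < r := by rw [Fin.lt_def] at h ⊢; omega
      have h4 : a ≠ r := fun h => h2 (by rw [h])
      have h5 : b ≠ r := fun h => h1 (by rw [h])
      simpa [h, h3, h4, h5] using hC

theorem skewTens_zero_apply (hn : 0 < n) (A B C : Matrix S S F) (k l : Fin n → S) :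
    skewTens A B C ⟨0, hn⟩ k l = B (k ⟨0, hn⟩) (l ⟨0, hn⟩) *
      ∏ s ∈ Finset.univ.erase ⟨0, hn⟩, C (k s) (l s) := by
  rw [skewTens, tens_apply_eq_mul_prod_erase _ ⟨0, hn⟩]
  rw [if_neg (lt_irrefl _), if_pos rfl]
  congr 1
  refine Finset.prod_congr rfl fun s hs => ?_
  simp [Fin.lt_def, Finset.ne_of_mem_erase hs]

theorem commute_flip_skewTens (hn : 0 < n) {ν : S → S} (hν : Function.Involutive ν) {w : S → F}
    {A B C : Matrix S S F} (hA : Commute (heckeMatrix ν w) A) {r : Fin n} (hr : r ≠ ⟨0, hn⟩) :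
    Commute (heckeMatrix (flipAt ν ⟨0, hn⟩) fun k => w (k ⟨0, hn⟩)) (skewTens A B C r) := by
  refine commute_flip_tens hn hν ?_
  have : (⟨0, hn⟩ : Fin n) < r := by
    have := Fin.val_ne_of_ne hr
    exact Nat.pos_of_ne_zero this
  simpa [this] using hA

end TensorCommute

section Specializations

open Polynomial

theorem Specializes.tens {ι S : Type*} [Fintype ι] [DecidableEq ι] [Fintype S] [DecidableEq S]
    {A : ι → Matrix S S K} {x : ι → Matrix S S ℚ} (h : ∀ r, Specializes (A r) (x r)) :
    Specializes (tens A) (tens x) :=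
  fun _ _ => HasValue.prod _ fun r _ => h r _ _

theorem Specializes.sum {I ι : Type*} [Fintype I] (s : Finset ι) {A : ι → Matrix I I K}
    {x : ι → Matrix I I ℚ} (h : ∀ r, Specializes (A r) (x r)) :
    Specializes (∑ r ∈ s, A r) (∑ r ∈ s, x r) := fun i j => by
  rw [Matrix.sum_apply, Matrix.sum_apply]
  exact HasValue.sum _ fun r _ => h r _ _

theorem Specializes.add {I : Type*} [Fintype I] {A B : Matrix I I K} {x y : Matrix I I ℚ}
    (hA : Specializes A x) (hB : Specializes B y) : Specializes (A + B) (x + y) :=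
  fun i j => (hA i j).add (hB i j)

theorem Specializes.smul {I : Type*} [Fintype I] {A : Matrix I I K} {x : Matrix I I ℚ}
    {c : K} (hc : HasValue c 1) (hA : Specializes A x) : Specializes (c • A) x :=
  fun i j => by simpa using hc.mul (hA i j)

theorem Specializes.single {I : Type*} [Fintype I] [DecidableEq I] (a b : I) :
    Specializes (Matrix.single a b (1 : K)) (Matrix.single a b 1) := fun i j => by
  rw [Matrix.single_apply, Matrix.single_apply]
  exact HasValue.ite (fun _ => HasValue.one) fun _ => HasValue.zero

theorem Specializes.diagonal {I : Type*} [Fintype I] [DecidableEq I] {d : I → K}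
    (hd : ∀ i, HasValue (d i) 1) : Specializes (Matrix.diagonal d) 1 := fun i j => by
  rw [Matrix.diagonal_apply, Matrix.one_apply]
  exact HasValue.ite (fun _ => hd i) fun _ => HasValue.zero

theorem Specializes.sum_skewTens {n : ℕ} {S : Type*} [Fintype S] [DecidableEq S]
    {A B C : Matrix S S K} {x : Matrix S S ℚ} (hA : Specializes A 1) (hB : Specializes B x)
    (hC : Specializes C 1) :
    Specializes (∑ r : Fin n, skewTens A B C r) (diagAction x) := by
  rw [diagAction_apply]
  refine Specializes.sum _ fun r => Specializes.tens fun s => ?_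
  by_cases h : s < r
  · simpa [h, Pi.mulSingle_eq_of_ne h.ne] using hA
  · by_cases h1 : s = r
    · subst h1; simpa using hB
    · simpa [h, h1, Pi.mulSingle_eq_of_ne h1] using hC

theorem Specializes.heckeMatrix {I : Type*} [Fintype I] [DecidableEq I] (p : I → I) {w : I → K}
    (hw : ∀ i, HasValue (w i) 0) : Specializes (heckeMatrix p w) (heckeMatrix p 0) :=
  fun _ j => (HasValue.ite (fun _ => HasValue.one) fun _ => HasValue.zero).add
    (HasValue.ite (fun _ => hw j) fun _ => HasValue.zero)

theorem hasValue_geom (e : ℕ) : HasValue ((q - 1)⁻¹ * (q ^ e - 1)) e := by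
  have hq : q - 1 ≠ 0 := by
    have h : (X - C 1 : ℚ[X]) ≠ 0 := X_sub_C_ne_zero 1
    intro h0
    apply h
    apply IsFractionRing.injective ℚ[X] K
    simpa [q] using h0
  induction e with
  | zero => simpa using HasValue.zero
  | succ e ih =>
    have h := (HasValue.q.mul ih).add HasValue.one
    have h1 : (q - 1)⁻¹ * (q ^ (e + 1) - 1) = q * ((q - 1)⁻¹ * (q ^ e - 1)) + 1 := by
      field_simp
      ring
    rw [h1]
    simpa using h

theorem tens_diagonal {ι S F : Type*} [Fintype ι] [DecidableEq ι] [Fintype S] [DecidableEq S]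
    [CommRing F] (d : ι → S → F) :
    tens (fun r => Matrix.diagonal (d r)) = Matrix.diagonal fun l => ∏ r, d r (l r) := by
  ext k l
  simp only [tens_apply, Matrix.diagonal_apply]
  rw [Finset.prod_ite_zero]
  by_cases h : k = l
  · simp [h]
  · have : ¬ ∀ r, k r = l r := fun h1 => h (funext h1)
    simp [h, this]

theorem diagAction_diagonal {ι S F : Type*} [Fintype ι] [DecidableEq ι] [Fintype S]
    [DecidableEq S] [CommRing F] (d : S → F) :
    diagAction (Matrix.diagonal d) = Matrix.diagonal fun l : ι → S => ∑ r, d (l r) := by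
  ext k l
  simp only [diagAction_apply, Matrix.sum_apply, tens_mulSingle_apply, Matrix.diagonal_apply,
    Matrix.one_apply]
  by_cases h : k = l
  · simp [h]
  · obtain ⟨s, hs⟩ := Function.ne_iff.1 h
    rw [if_neg h]
    refine Finset.sum_eq_zero fun r _ => ?_
    by_cases hr : s = r
    · subst hr; simp [hs]
    · rw [Finset.prod_eq_zero (Finset.mem_erase.2 ⟨hr, Finset.mem_univ s⟩) (if_neg hs), mul_zero]

/-- The divided difference at `q = 1` of a group-like diagonal operator. -/
theorem specializes_divided_difference {ι S : Type*} [Fintype ι] [DecidableEq ι] [Fintype S]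
    [DecidableEq S] (e : S → ℕ) :
    Specializes ((q - 1)⁻¹ • (tens (fun _ : ι => Matrix.diagonal fun a : S => q ^ e a) - 1))
      (diagAction (Matrix.diagonal fun a => (e a : ℚ))) := by
  rw [tens_diagonal, diagAction_diagonal]
  intro k l
  rw [Matrix.smul_apply, Matrix.sub_apply, Matrix.diagonal_apply, Matrix.diagonal_apply,
    Matrix.one_apply]
  by_cases h : k = l
  · simpa [h, Finset.prod_pow_eq_pow_sum] using hasValue_geom (∑ r, e (k r))
  · simpa [h] using HasValue.zero

end Specializations

end IotaSchur

namespace IotaSchur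

open scoped Kronecker

instance (M : ℕ) : Fintype (SubI M) := inferInstanceAs (Fintype {a // a ∈ II M})

section Index

variable {M : ℕ}

theorem exists_eq_natCast_sub (a : SubI M) : ∃ k < M, a.1 = (k : ℚ) - ((M : ℚ) - 1) / 2 := by
  obtain ⟨k, hk, h⟩ := Finset.mem_image.1 a.2
  exact ⟨k, Finset.mem_range.1 hk, h.symm⟩

theorem natCast_sub_mem_II {k : ℕ} (hk : k < M) : (k : ℚ) - ((M : ℚ) - 1) / 2 ∈ II M :=
  Finset.mem_image.2 ⟨k, Finset.mem_range.2 hk, rfl⟩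

theorem lt_iff_lt_of_step {x y c : SubI M} (hxy : y.1 = x.1 + 1) (hx : c ≠ x) (hy : c ≠ y) :
    c.1 < x.1 ↔ c.1 < y.1 := by
  have hx' : c.1 ≠ x.1 := fun h => hx (Subtype.ext h)
  have hy' : c.1 ≠ y.1 := fun h => hy (Subtype.ext h)
  obtain ⟨k, -, hk⟩ := exists_eq_natCast_sub c
  obtain ⟨l, -, hl⟩ := exists_eq_natCast_sub x
  rw [hxy] at hy' ⊢
  rw [hk, hl] at hx' hy' ⊢
  have h1 : k ≠ l := fun h => hx' (by rw [h])
  have h2 : k ≠ l + 1 := fun h => hy' (by rw [h]; push_cast; ring)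
  have h3 : ((k : ℚ) - ((M : ℚ) - 1) / 2 < (l : ℚ) - ((M : ℚ) - 1) / 2) ↔ k < l := by
    rw [sub_lt_sub_iff_right, Nat.cast_lt]
  have h4 : ((k : ℚ) - ((M : ℚ) - 1) / 2 < (l : ℚ) - ((M : ℚ) - 1) / 2 + 1) ↔ k < l + 1 := by
    rw [sub_add_eq_add_sub, sub_lt_sub_iff_right]; norm_cast
  rw [h3, h4]
  omega

theorem negS_involutive : Function.Involutive (negS : SubI M → SubI M) :=
  fun a => Subtype.ext (neg_neg a.1)

theorem ne_zero_of_even {m : ℕ} (a : SubI (2 * m)) : a.1 ≠ 0 := by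
  obtain ⟨k, -, hk⟩ := exists_eq_natCast_sub a
  rw [hk]
  intro h
  have h1 : (2 * k + 1 : ℚ) = 2 * m := by push_cast at h; linarith
  have h2 : 2 * k + 1 = 2 * m := by exact_mod_cast h1
  omega

end Index

section TwoSites

variable {M : ℕ}

/-- The diagonal part of `σ` on two adjacent tensor positions. -/
def swapWeight (c : SubI M × SubI M) : K :=
  if c.1.1 < c.2.1 then 0 else if c.1.1 = c.2.1 then q⁻¹ - 1 else q⁻¹ - q

/-- The diagonal entries of `K_i⁻¹` for `x = i - 1/2`, `y = i + 1/2`. -/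
def stepDiag (x y c : SubI M) : K := if c = y then q else if c = x then q⁻¹ else 1

theorem swapWeight_of_lt {a b : SubI M} (h : a.1 < b.1) : swapWeight (a, b) = 0 := if_pos h

theorem swapWeight_of_gt {a b : SubI M} (h : b.1 < a.1) : swapWeight (a, b) = q⁻¹ - q := by
  rw [swapWeight, if_neg h.not_gt, if_neg h.ne']

theorem swapWeight_self (a : SubI M) : swapWeight (a, a) = q⁻¹ - 1 := by
  rw [swapWeight, if_neg (lt_irrefl _), if_pos rfl]

theorem swapWeight_step {x y c : SubI M} (hxy : y.1 = x.1 + 1) (hx : c ≠ x) (hy : c ≠ y) :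
    swapWeight (x, c) = swapWeight (y, c) ∧ swapWeight (c, x) = swapWeight (c, y) := by
  have h := lt_iff_lt_of_step hxy hx hy
  have hx' : c.1 ≠ x.1 := fun h => hx (Subtype.ext h)
  have hy' : c.1 ≠ y.1 := fun h => hy (Subtype.ext h)
  rcases lt_or_gt_of_ne hx' with h1 | h1
  · have h2 := h.1 h1
    simp only [swapWeight_of_lt h1, swapWeight_of_lt h2, swapWeight_of_gt h1, swapWeight_of_gt h2,
      and_self]
  · have h2 : y.1 < c.1 := lt_of_le_of_ne (not_lt.1 fun h2 => h1.not_gt (h.2 h2)) hy'.symm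
    simp only [swapWeight_of_lt h1, swapWeight_of_lt h2, swapWeight_of_gt h1, swapWeight_of_gt h2,
      and_self]

theorem commute_swap_raise {x y : SubI M} (hxy : y.1 = x.1 + 1) :
    Commute (heckeMatrix Prod.swap swapWeight)
      (Matrix.single y x (1 : K) ⊗ₖ Matrix.diagonal (stepDiag x y)
        + (1 : Matrix _ _ K) ⊗ₖ Matrix.single y x (1 : K)) := by
  have hlt : x.1 < y.1 := by rw [hxy]; linarith
  have hne : x ≠ y := fun h => hlt.ne (by rw [h])
  have hq := q_ne_zero
  have hw₁ := swapWeight_of_lt hlt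
  have hw₂ := swapWeight_of_gt hlt
  rw [commute_heckeMatrix_iff Prod.swap_swap]
  rintro ⟨k, k'⟩ ⟨l, l'⟩
  simp only [Matrix.add_apply, Matrix.kroneckerMap_apply, Matrix.single_apply,
    Matrix.diagonal_apply, Matrix.one_apply, Prod.swap_prod_mk]
  have hne' := hne.symm
  by_cases hl : x = l
  · subst hl
    by_cases hl' : x = l'
    · subst hl'
      by_cases h1 : k = x <;> by_cases h2 : k' = x <;> by_cases h3 : y = k <;>
        by_cases h4 : y = k' <;> simp_all [stepDiag, swapWeight_self] <;> field_simp <;> ring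
    · by_cases hl'' : l' = y
      · subst hl''
        by_cases h1 : l' = k <;> by_cases h2 : l' = k' <;> by_cases h3 : k = x <;>
          by_cases h4 : k' = x <;> simp_all [stepDiag, swapWeight_self] <;> grind
      · obtain ⟨hw, -⟩ := swapWeight_step hxy (Ne.symm hl') hl''
        have hl₁ := Ne.symm hl'
        clear hw₁ hw₂ hxy hlt
        by_cases h1 : k = l' <;> by_cases h2 : k' = l' <;> by_cases h3 : y = k <;>
          by_cases h4 : y = k' <;> simp_all [stepDiag]
  · by_cases hl' : x = l'
    · subst hl'
      by_cases hl'' : l = y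
      · subst hl''
        by_cases h1 : l = k <;> by_cases h2 : l = k' <;> by_cases h3 : k = x <;>
          by_cases h4 : k' = x <;> simp_all [stepDiag, swapWeight_self] <;> grind
      · obtain ⟨-, hw⟩ := swapWeight_step hxy (Ne.symm hl) hl''
        have hl₁ := Ne.symm hl
        clear hw₁ hw₂ hxy hlt
        by_cases h1 : k = l <;> by_cases h2 : k' = l <;> by_cases h3 : y = k <;>
          by_cases h4 : y = k' <;> simp_all [stepDiag]
    · simp [hl, hl']

end TwoSites

end IotaSchur

namespace IotaSchur

section OperatorMatrices

variable {M : ℕ}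

theorem subI_ext_iff {a b : SubI M} : a = b ↔ a.1 = b.1 := Subtype.ext_iff

/-- The matrix of a single-target operator on `V`. -/
def opMatrix (O : SOp) : Matrix (SubI M) (SubI M) K :=
  Matrix.of fun b a => if b.1 = O.t a.1 then O.c a.1 else 0

theorem opMatrix_apply (O : SOp) (b a : SubI M) :
    opMatrix O b a = if b.1 = O.t a.1 then O.c a.1 else 0 := rfl

theorem opMatrix_eq_diagonal {O : SOp} (ht : ∀ a, O.t a = a) {d : SubI M → K}
    (hd : ∀ a : SubI M, O.c a.1 = d a) : opMatrix O = Matrix.diagonal d := by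
  ext b a
  rw [opMatrix_apply, Matrix.diagonal_apply, ht, hd]
  by_cases h : b = a
  · simp [h]
  · rw [if_neg h, if_neg fun h' => h (Subtype.ext h')]

theorem opMatrix_eq_smul_single {O : SOp} {x y : SubI M} (ht : O.t x.1 = y.1)
    (hc : ∀ a : SubI M, a ≠ x → O.c a.1 = 0) :
    opMatrix O = O.c x.1 • Matrix.single y x (1 : K) := by
  ext b a
  rw [opMatrix_apply, Matrix.smul_apply, Matrix.single_apply]
  by_cases h : a = x
  · subst h
    rw [ht]
    by_cases h' : b = y
    · simp [h']
    · rw [if_neg fun h'' => h' (Subtype.ext h''), if_neg fun h'' => h' h''.1.symm, smul_zero]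
  · rw [hc a h, ite_self, if_neg fun h' => h h'.2.symm, smul_zero]

/-- The matrix of an operator on `V^{⊗n}` in the standard basis. -/
abbrev toMat (n M : ℕ) :
    Module.End K (TV n M) ≃ₐ[K] Matrix (Fin n → SubI M) (Fin n → SubI M) K :=
  LinearMap.toMatrixAlgEquiv (Finsupp.basisSingleOne (R := K) (ι := Fin n → SubI M))

theorem toMat_apply {n : ℕ} (f : Module.End K (TV n M)) (k l : Fin n → SubI M) :
    toMat n M f k l = f (Finsupp.single l 1) k := by
  rw [LinearMap.toMatrixAlgEquiv_apply]
  simp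

theorem toMat_tensorOp {n : ℕ} (ops : Fin n → SOp) :
    toMat n M (tensorOp ops) = tens fun r => opMatrix (ops r) := by
  ext k l
  rw [toMat_apply, tensorOp, Finsupp.lift_apply, Finsupp.sum_single_index (by simp), one_smul,
    tens_apply]
  simp only [opMatrix_apply]
  rw [Finset.prod_ite_zero]
  split_ifs with h h' h'
  · exact Finsupp.single_apply.trans
      (if_pos (funext fun r => Subtype.ext (h' r (Finset.mem_univ r)).symm))
  · exact Finsupp.single_apply.trans (if_neg fun h'' => h' fun r _ => by rw [← h''])
  · exact absurd (fun r => by rw [← h' r (Finset.mem_univ r)]; exact (k r).2) h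
  · rfl

theorem toMat_tensorOp_skew {n : ℕ} (A B C : SOp) (r : Fin n) :
    toMat n M (tensorOp fun s => if s < r then A else if s = r then B else C)
      = skewTens (opMatrix A) (opMatrix B) (opMatrix C) r := by
  rw [toMat_tensorOp, skewTens]
  congr 1
  funext s
  split_ifs <;> rfl

theorem opMatrix_id : opMatrix (M := M) SOp.id' = 1 :=
  opMatrix_eq_diagonal (fun _ => rfl) fun _ => rfl

section Step

variable {x y : SubI M}

theorem opMatrix_Fop (hxy : y.1 = x.1 + 1) : opMatrix (Fop (x.1 + 1 / 2)) = Matrix.single y x (1 : K) := by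
  rw [opMatrix_eq_smul_single (x := x) (y := y) hxy.symm]
  · simp [Fop]
  · intro a ha
    exact if_neg fun h => ha (Subtype.ext (by rw [h]; ring))

theorem Kinv_c (hxy : y.1 = x.1 + 1) (a : SubI M) : (Kinv (x.1 + 1 / 2)).c a.1 = stepDiag x y a := by
  have h1 : a.1 = x.1 + 1 / 2 + 1 / 2 ↔ a = y := by
    rw [subI_ext_iff, hxy]; ring_nf
  have h2 : a.1 = x.1 + 1 / 2 - 1 / 2 ↔ a = x := by
    rw [subI_ext_iff]; ring_nf
  have hne : x ≠ y := fun h => by rw [h] at hxy; linarith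
  simp only [Kinv, diagOp, h1, h2, stepDiag]
  by_cases hy : a = y
  · have hx : a ≠ x := fun h => hne (by rw [← h, hy])
    simp [hy, hne.symm]
  · by_cases hx : a = x <;> simp [hx, hy, hne]

theorem Kpos_neg_c (hxy : y.1 = x.1 + 1) (a : SubI M) :
    (Kpos (-(x.1 + 1 / 2))).c a.1 = stepDiag x y (negS a) := by
  rw [← Kinv_c hxy]
  have h1 : a.1 = -(x.1 + 1 / 2) - 1 / 2 ↔ -a.1 = x.1 + 1 / 2 + 1 / 2 := by
    constructor <;> intro h <;> linarith
  have h2 : a.1 = -(x.1 + 1 / 2) + 1 / 2 ↔ -a.1 = x.1 + 1 / 2 - 1 / 2 := by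
    constructor <;> intro h <;> linarith
  simp only [Kpos, Kinv, diagOp, negS, h1, h2]

theorem opMatrix_Kinv (hxy : y.1 = x.1 + 1) :
    opMatrix (Kinv (x.1 + 1 / 2)) = Matrix.diagonal (stepDiag x y) :=
  opMatrix_eq_diagonal (fun _ => rfl) (Kinv_c hxy)

theorem opMatrix_kinv (hxy : y.1 = x.1 + 1) : opMatrix (kinv (x.1 + 1 / 2)) =
    Matrix.diagonal fun a => stepDiag x y (negS a) * stepDiag x y a :=
  opMatrix_eq_diagonal (fun _ => rfl) fun a => by
    rw [← Kinv_c hxy a, ← Kpos_neg_c hxy a]; rfl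

theorem opMatrix_Eop_comp_Kinv (hxy : y.1 = x.1 + 1) :
    opMatrix ((Eop (-(x.1 + 1 / 2))).comp (Kinv (x.1 + 1 / 2))) =
      stepDiag x y (negS x) • Matrix.single (negS y) (negS x) (1 : K) := by
  rw [opMatrix_eq_smul_single (x := negS x) (y := negS y), ← Kinv_c hxy]
  · congr 1
    change _ * (if -x.1 = -(x.1 + 1 / 2) + 1 / 2 then (1 : K) else 0) = _
    rw [if_pos (by ring), mul_one]
  · change -x.1 - 1 = -y.1
    rw [hxy]; ring
  · intro a ha
    change _ * (if a.1 = -(x.1 + 1 / 2) + 1 / 2 then (1 : K) else 0) = _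
    rw [if_neg fun h => ha (Subtype.ext (by rw [h]; change _ = -x.1; ring)), mul_zero]

theorem toMat_calB (hxy : y.1 = x.1 + 1) (n : ℕ) : toMat n M (calB n M (x.1 + 1 / 2)) =
    (∑ r, skewTens 1 (Matrix.single y x (1 : K)) (Matrix.diagonal (stepDiag x y)) r) +
    ∑ r, skewTens (Matrix.diagonal fun a => stepDiag x y (negS a) * stepDiag x y a)
      (stepDiag x y (negS x) • Matrix.single (negS y) (negS x) (1 : K))
      (Matrix.diagonal (stepDiag x y)) r := by
  rw [calB, map_add, map_sum, map_sum]
  simp only [toMat_tensorOp_skew, opMatrix_id, opMatrix_Fop hxy, opMatrix_Kinv hxy,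
    opMatrix_kinv hxy, opMatrix_Eop_comp_Kinv hxy]

theorem toMat_calB0 (hxy : y.1 = x.1 + 1) (n : ℕ) (hx : negS x = y) : toMat n M (calB0 n M) =
    (∑ r, skewTens 1 (Matrix.single y x (1 : K)) (Matrix.diagonal (stepDiag x y)) r) +
    q⁻¹ • (∑ r, skewTens 1 (q • Matrix.single x y (1 : K)) (Matrix.diagonal (stepDiag x y)) r) +
    tens fun _ => Matrix.diagonal (stepDiag x y) := by
  have h0 : x.1 + 1 / 2 = 0 := by
    rw [← hx] at hxy
    have : -x.1 = x.1 + 1 := hxy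
    linarith
  have hy : negS y = x := by rw [← hx, negS_involutive]
  have h1 := opMatrix_Fop hxy
  have h2 := opMatrix_Kinv hxy
  have h3 := opMatrix_Eop_comp_Kinv hxy
  rw [hx, hy, show stepDiag x y y = q from if_pos rfl] at h3
  rw [h0] at h1 h2 h3
  rw [neg_zero] at h3
  rw [calB0, map_add, map_add, map_smul, map_sum, map_sum, toMat_tensorOp fun _ => Kinv 0]
  simp only [toMat_tensorOp_skew, opMatrix_id, h1, h2, h3]

end Step

theorem toMat_calD (n : ℕ) (r : SubI M) (e : ℤ) : toMat n M (calD n M r.1 e) =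
    tens fun _ => Matrix.diagonal fun a : SubI M =>
      q ^ (e * ((if a = r then 1 else 0) + (if a = negS r then 1 else 0))) := by
  rw [calD, toMat_tensorOp]
  congr 1
  funext _
  refine opMatrix_eq_diagonal (fun _ => rfl) fun a => ?_
  simp only [DDop, diagOp, subI_ext_iff]
  rfl

/-- The diagonal part of `σ_0`. -/
def flipWeight (a : SubI M) : K := if 0 < a.1 then 0 else q⁻¹ - q

theorem toMat_sigmaI {n : ℕ} (a b : Fin n) : toMat n M (sigmaI a b) =
    heckeMatrix (fun k => k ∘ Equiv.swap a b) fun k => swapWeight (k a, k b) := by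
  ext k l
  rw [toMat_apply, sigmaI, Finsupp.lift_apply, Finsupp.sum_single_index (by simp), one_smul]
  have h : (l a).1 = (l b).1 → l ∘ Equiv.swap a b = l := fun h => by
    funext s
    have h' : l a = l b := Subtype.ext h
    rw [Function.comp_apply, Equiv.swap_apply_def]
    split_ifs with h1 h2
    · rw [h1, h']
    · rw [h2, h']
    · rfl
  have ht : ∀ l' : Fin n → SubI M, tT l' k = if k = l' then 1 else 0 := fun l' =>
    (Finsupp.single_apply).trans (by simp only [eq_comm])
  simp only [heckeMatrix, Matrix.of_apply, swapWeight, swapL]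
  rcases lt_trichotomy (l a).1 (l b).1 with h1 | h1 | h1
  · simp only [if_pos h1, ht, ite_self, add_zero]
  · simp only [h1, lt_irrefl, if_true, if_false, Finsupp.smul_apply, ht, smul_eq_mul, h h1]
    by_cases h2 : k = l <;> simp [h2]
  · simp only [if_neg h1.not_gt, if_neg h1.ne', Finsupp.add_apply, Finsupp.smul_apply, ht,
      smul_eq_mul, mul_ite, mul_one, mul_zero]

theorem toMat_sigma0 {m n : ℕ} (hn : 0 < n) : toMat n (2 * m) (sigma0 hn) =
    heckeMatrix (flipAt negS ⟨0, hn⟩) fun k => flipWeight (k ⟨0, hn⟩) := by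
  ext k l
  rw [toMat_apply, sigma0, Finsupp.lift_apply, Finsupp.sum_single_index (by simp), one_smul]
  rw [if_neg (ne_zero_of_even (l ⟨0, hn⟩))]
  have ht : ∀ l' : Fin n → SubI (2 * m), tT l' k = if k = l' then 1 else 0 := fun l' =>
    (Finsupp.single_apply).trans (by simp only [eq_comm])
  simp only [heckeMatrix, Matrix.of_apply, flipWeight, flipAt]
  by_cases h1 : 0 < (l ⟨0, hn⟩).1
  · simp only [if_pos h1, ht, ite_self, add_zero]
    congr
  · simp only [if_neg h1, Finsupp.add_apply, Finsupp.smul_apply, ht, smul_eq_mul, mul_ite, mul_one,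
      mul_zero]
    congr

end OperatorMatrices

end IotaSchur

namespace IotaSchur

open scoped Kronecker

section SwapCommute

variable {M : ℕ}

theorem commute_heckeMatrix_transpose {J F : Type*} [Fintype J] [DecidableEq J] [CommRing F]
    {p : J → J} (hp : Function.Involutive p) {w : J → F} {X : Matrix J J F}
    (h : Commute (heckeMatrix p w) X) : Commute (heckeMatrix p w) X.transpose := by
  have h' := congrArg Matrix.transpose h.eq
  rw [Matrix.transpose_mul, Matrix.transpose_mul, heckeMatrix_transpose hp] at h'
  exact h'.symm

theorem commute_swap_diagonal {S : Type*} [Fintype S] [DecidableEq S] (w : S × S → K) (d : S → K) :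
    Commute (heckeMatrix Prod.swap w) (Matrix.diagonal d ⊗ₖ Matrix.diagonal d) := by
  rw [Matrix.diagonal_kronecker_diagonal]
  exact commute_heckeMatrix_diagonal Prod.swap_swap _ fun k => mul_comm _ _

theorem commute_swap_one {S : Type*} [Fintype S] [DecidableEq S] (w : S × S → K) :
    Commute (heckeMatrix Prod.swap w) ((1 : Matrix S S K) ⊗ₖ (1 : Matrix S S K)) := by
  rw [Matrix.one_kronecker_one]
  exact Commute.one_right _

variable {x y : SubI M}

theorem commute_swap_lower (hxy : y.1 = x.1 + 1) : Commute (heckeMatrix Prod.swap swapWeight)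
    (Matrix.single x y (1 : K) ⊗ₖ Matrix.diagonal (stepDiag x y)
      + (1 : Matrix _ _ K) ⊗ₖ Matrix.single x y (1 : K)) := by
  have h := commute_heckeMatrix_transpose Prod.swap_swap (commute_swap_raise hxy)
  rwa [Matrix.transpose_add, ← Matrix.kroneckerMap_transpose, ← Matrix.kroneckerMap_transpose,
    Matrix.transpose_single, Matrix.diagonal_transpose, Matrix.transpose_one] at h

theorem step_ne (hxy : y.1 = x.1 + 1) : x ≠ y := fun h => by rw [h] at hxy; linarith

theorem negS_step (hxy : y.1 = x.1 + 1) : (negS x).1 = (negS y).1 + 1 := by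
  change -x.1 = -y.1 + 1
  rw [hxy]; ring

theorem stepDiag_negS_mul (hxy : y.1 = x.1 + 1) (a : SubI M) :
    stepDiag x y (negS a) * stepDiag (negS y) (negS x) a = 1 := by
  have hq := q_ne_zero
  have h1 : ∀ b : SubI M, negS a = b ↔ a = negS b := fun b =>
    ⟨fun h => by rw [← h, negS_involutive], fun h => by rw [h, negS_involutive]⟩
  have hne : negS x ≠ negS y := fun h => step_ne hxy (negS_involutive.injective h)
  simp only [stepDiag, h1]
  by_cases h2 : a = negS x
  · simp [h2, hne, hq]
  · by_cases h3 : a = negS y <;> simp [h2, h3, hne.symm, hq]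

theorem commute_swap_sum_raise (hxy : y.1 = x.1 + 1) {n : ℕ} {a b : Fin n} (hab : a.val + 1 = b.val) :
    Commute (heckeMatrix (fun k : Fin n → SubI M => k ∘ Equiv.swap a b)
        fun k => swapWeight (k a, k b))
      (∑ r, skewTens 1 (Matrix.single y x (1 : K)) (Matrix.diagonal (stepDiag x y)) r) :=
  commute_swap_sum_skewTens hab (commute_swap_one _) (commute_swap_diagonal _ _)
    (commute_swap_raise hxy)

theorem commute_swap_sum_lower (hxy : y.1 = x.1 + 1) {n : ℕ} {a b : Fin n} (hab : a.val + 1 = b.val) :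
    Commute (heckeMatrix (fun k : Fin n → SubI M => k ∘ Equiv.swap a b)
        fun k => swapWeight (k a, k b))
      (∑ r, skewTens (Matrix.diagonal fun a => stepDiag x y (negS a) * stepDiag x y a)
        (stepDiag x y (negS x) • Matrix.single (negS y) (negS x) (1 : K))
        (Matrix.diagonal (stepDiag x y)) r) := by
  refine commute_swap_sum_skewTens hab (commute_swap_diagonal _ _) (commute_swap_diagonal _ _) ?_
  have h := ((commute_swap_lower (negS_step hxy)).mul_right
    (commute_swap_diagonal swapWeight fun a => stepDiag x y (negS a))).mul_right
    (commute_swap_diagonal swapWeight (stepDiag x y))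
  have hy : stepDiag x y (negS (negS x)) = q⁻¹ := by
    rw [negS_involutive, stepDiag, if_neg (step_ne hxy), if_pos rfl]
  have hs : ∀ (d : SubI M → K) (s t : SubI M),
      Matrix.single s t (1 : K) * Matrix.diagonal d = d t • Matrix.single s t (1 : K) :=
    fun d s t => by
      ext i j
      rw [Matrix.mul_diagonal, Matrix.smul_apply, Matrix.single_apply]
      by_cases hj : t = j
      · subst hj; simp [ite_mul]
      · simp [hj]
  have hd : ∀ a, stepDiag (negS y) (negS x) a * stepDiag x y (negS a) = 1 := fun a => by
    rw [mul_comm, stepDiag_negS_mul hxy]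
  refine (?_ : Commute _ (q • _) ↔ _).1 (h.smul_right q)
  rw [iff_eq_eq]
  congr 1
  simp only [add_mul, ← Matrix.mul_kronecker_mul, Matrix.diagonal_mul_diagonal, one_mul, hs, hy, hd,
    smul_mul_assoc, Matrix.smul_kronecker, Matrix.kronecker_smul, smul_add, smul_smul, ← mul_assoc,
    mul_inv_cancel₀ q_ne_zero]

end SwapCommute

section FlipCommute

variable {m : ℕ} {x y : SubI (2 * m)}

theorem flipWeight_eq_of_step (hxy : y.1 = x.1 + 1) (hx : negS x ≠ y) :
    flipWeight x = flipWeight y ∧ flipWeight (negS x) = flipWeight (negS y) := by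
  obtain ⟨k, -, hk⟩ := exists_eq_natCast_sub x
  have h0 : x.1 + 1 / 2 ≠ 0 := fun h => hx (Subtype.ext (by
    change -x.1 = y.1
    rw [hxy]; linarith))
  have h1 : k + 1 ≠ m := fun h => h0 (by
    rw [hk, ← h]; push_cast; ring)
  have h2 : 0 < x.1 ↔ m ≤ k := by
    rw [hk]
    constructor
    · intro h
      have : (2 * m : ℚ) < 2 * k + 1 := by push_cast at h; linarith
      have : 2 * m < 2 * k + 1 := by exact_mod_cast this
      omega
    · intro h
      have : (m : ℚ) ≤ k := by exact_mod_cast h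
      push_cast
      linarith
  have h3 : 0 < y.1 ↔ m ≤ k := by
    rw [hxy, hk]
    constructor
    · intro h
      have : (2 * m : ℚ) < 2 * k + 3 := by push_cast at h; linarith
      have : 2 * m < 2 * k + 3 := by exact_mod_cast this
      omega
    · intro h
      have : (m : ℚ) ≤ k := by exact_mod_cast h
      push_cast
      linarith
  have h4 : ∀ a : SubI (2 * m), 0 < (negS a).1 ↔ ¬ 0 < a.1 := fun a => by
    have := ne_zero_of_even a
    change 0 < -a.1 ↔ _
    rw [neg_pos, not_lt, le_iff_lt_or_eq, or_iff_left this]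
  simp only [flipWeight, h2, h3, h4, and_self]

theorem commute_flip_signedUnit (hw : flipWeight x = flipWeight y)
    (hw' : flipWeight (negS x) = flipWeight (negS y)) :
    Commute (heckeMatrix negS flipWeight) (signedUnit negS K y x) := by
  rw [commute_heckeMatrix_iff negS_involutive]
  intro k l
  have h1 : ∀ a b : SubI (2 * m), a = negS b ↔ negS a = b := fun b c =>
    ⟨fun h => by rw [h, negS_involutive], fun h => by rw [← h, negS_involutive]⟩
  have h2 : signedUnit negS K y x (negS k) l = signedUnit negS K y x k (negS l) := by
    simp only [signedUnit, Matrix.add_apply, Matrix.single_apply, h1, (negS_involutive y : negS (negS y) = y),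
      (negS_involutive x : negS (negS x) = x)]
    exact add_comm _ _
  have h3 : flipWeight k * signedUnit negS K y x k l =
      signedUnit negS K y x k l * flipWeight l := by
    simp only [signedUnit, Matrix.add_apply, Matrix.single_apply, mul_add, add_mul]
    congr 1
    · split_ifs with h
      · rw [← h.1, ← h.2, hw, mul_comm]
      · rw [mul_zero, zero_mul]
    · split_ifs with h
      · rw [← h.1, ← h.2, hw', mul_comm]
      · rw [mul_zero, zero_mul]
  rw [h2, h3]

theorem commute_flip_calB (n : ℕ) (hn : 0 < n) (hxy : y.1 = x.1 + 1) (hx : negS x ≠ y) :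
    Commute (toMat n (2 * m) (sigma0 hn)) (toMat n (2 * m) (calB n (2 * m) (x.1 + 1 / 2))) := by
  rw [toMat_sigma0, toMat_calB hxy, ← Finset.add_sum_erase _ _ (Finset.mem_univ ⟨0, hn⟩),
    ← Finset.add_sum_erase _ (skewTens (Matrix.diagonal _) _ _) (Finset.mem_univ ⟨0, hn⟩),
    add_add_add_comm]
  have hD : stepDiag x y (negS x) = 1 := by
    rw [stepDiag, if_neg hx, if_neg fun h => ne_zero_of_even x (by
      have h' : -x.1 = x.1 := congrArg Subtype.val h
      linarith)]
  obtain ⟨hw, hw'⟩ := flipWeight_eq_of_step hxy hx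
  refine Commute.add_right ?_ (Commute.add_right ?_ ?_)
  · refine commute_flip_of_apply_eq hn negS_involutive (commute_flip_signedUnit hw hw')
      (fun _ => Matrix.diagonal (stepDiag x y)) fun k l => ?_
    rw [Matrix.add_apply, skewTens_zero_apply, skewTens_zero_apply, ← add_mul, hD, one_smul]
    rfl
  · exact Commute.sum_right _ _ _ fun r hr => commute_flip_skewTens hn negS_involutive
      (Commute.one_right _) (Finset.ne_of_mem_erase hr)
  · exact Commute.sum_right _ _ _ fun r hr => commute_flip_skewTens hn negS_involutive
      (commute_heckeMatrix_diagonal negS_involutive _ fun a => by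
        rw [negS_involutive, mul_comm]) (Finset.ne_of_mem_erase hr)

theorem commute_flip_calB0 (n : ℕ) (hn : 0 < n) (hxy : y.1 = x.1 + 1) (hx : negS x = y) :
    Commute (toMat n (2 * m) (sigma0 hn)) (toMat n (2 * m) (calB0 n (2 * m))) := by
  have hy : negS y = x := by rw [← hx, negS_involutive]
  have hq := q_ne_zero
  have hne := step_ne hxy
  have hx0 : ¬ 0 < x.1 := by
    rw [← hx] at hxy
    have : -x.1 = x.1 + 1 := hxy
    linarith
  have hy0 : 0 < y.1 := by
    rw [← hx]
    exact neg_pos.2 (lt_of_le_of_ne (not_lt.1 hx0) (ne_zero_of_even x))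
  rw [toMat_sigma0, toMat_calB0 hxy n hx, ← Finset.add_sum_erase _ _ (Finset.mem_univ ⟨0, hn⟩),
    ← Finset.add_sum_erase _ (skewTens 1 (q • _) _) (Finset.mem_univ ⟨0, hn⟩), smul_add,
    add_add_add_comm, add_right_comm]
  refine Commute.add_right ?_ (Commute.add_right ?_ (Commute.smul_right ?_ _))
  · have hY : Commute (heckeMatrix negS flipWeight) (Matrix.single y x (1 : K)
        + Matrix.single x y (1 : K) + Matrix.diagonal (stepDiag x y)) := by
      rw [commute_heckeMatrix_iff negS_involutive]
      have hwx : flipWeight x = q⁻¹ - q := if_neg hx0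
      have hwy : flipWeight y = 0 := if_pos hy0
      have h1 : ∀ b c : SubI (2 * m), b = negS c ↔ negS b = c := fun b c =>
        ⟨fun h => by rw [h, negS_involutive], fun h => by rw [← h, negS_involutive]⟩
      intro k l
      simp only [Matrix.add_apply, Matrix.single_apply, Matrix.diagonal_apply, h1, hx, hy]
      have hdx : stepDiag x y x = q⁻¹ := by rw [stepDiag, if_neg hne, if_pos rfl]
      have hdy : stepDiag x y y = q := if_pos rfl
      have hne' := hne.symm
      clear hxy hx0 hy0
      by_cases hlx : l = x
      · subst hlx
        by_cases hkx : k = l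
        · subst hkx
          simp [hne', mul_comm, hx]
        · by_cases hky : k = y
          · subst hky
            simp [hne, hne', hy, hwx, hwy, hdx, hdy]
          · have h2 : negS k ≠ l := fun h => hky (by rw [← hx, ← h, negS_involutive])
            simp [hkx, Ne.symm hkx, Ne.symm hky, h2]
      · by_cases hly : l = y
        · subst hly
          by_cases hkx : k = x
          · subst hkx
            simp [hne, hne', hx, hwx, hwy, hdx, hdy]
          · by_cases hky : k = l
            · subst hky
              simp [hne, mul_comm, hy]
            · have h2 : negS k ≠ l := fun h => hkx (by rw [← hy, ← h, negS_involutive])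
              simp [hky, Ne.symm hkx, Ne.symm hky, h2]
        · have hlx' := Ne.symm hlx
          have hly' := Ne.symm hly
          by_cases hkx : k = x
          · subst hkx
            simp [hx, hlx', hly']
          · by_cases hky : k = y
            · subst hky
              simp [hy, hlx', hly']
            · have hkx' : negS k ≠ y := fun h => hkx (by rw [← hy, ← h, negS_involutive])
              have hky' : negS k ≠ x := fun h => hky (by rw [← hx, ← h, negS_involutive])
              by_cases hkl : k = l
              · subst hkl
                simp [hlx', hly', stepDiag, hkx, hky, hkx', hky', mul_comm]
              · simp [hlx', hly', hkl, stepDiag, hkx, hky, hkx', hky']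
    refine commute_flip_of_apply_eq hn negS_involutive hY
      (fun _ => Matrix.diagonal (stepDiag x y)) fun k l => ?_
    rw [Matrix.add_apply, Matrix.add_apply, Matrix.smul_apply, skewTens_zero_apply,
      skewTens_zero_apply, tens_apply_eq_mul_prod_erase _ ⟨0, hn⟩, Matrix.add_apply,
      Matrix.add_apply, add_mul, add_mul, Matrix.smul_apply, smul_eq_mul, smul_eq_mul, mul_assoc q,
      inv_mul_cancel_left₀ hq]
  · exact Commute.sum_right _ _ _ fun r hr => commute_flip_skewTens hn negS_involutive
      (Commute.one_right _) (Finset.ne_of_mem_erase hr)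
  · exact Commute.sum_right _ _ _ fun r hr => commute_flip_skewTens hn negS_involutive
      (Commute.one_right _) (Finset.ne_of_mem_erase hr)

end FlipCommute

end IotaSchur

namespace IotaSchur

open scoped Kronecker

section Generators

variable {m n : ℕ}

theorem exists_step_of_mem_II {i : ℚ} (hi : i ∈ II (2 * m - 1)) :
    ∃ x y : SubI (2 * m), y.1 = x.1 + 1 ∧ i = x.1 + 1 / 2 := by
  obtain ⟨k, hk, rfl⟩ := Finset.mem_image.1 hi
  rw [Finset.mem_range] at hk
  refine ⟨⟨_, natCast_sub_mem_II (k := k) (by omega)⟩,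
    ⟨_, natCast_sub_mem_II (k := k + 1) (by omega)⟩, ?_, ?_⟩
  · push_cast; ring
  · rw [Nat.cast_sub (by omega)]; push_cast; ring

theorem step_mem_II {x y : SubI (2 * m)} (hxy : y.1 = x.1 + 1) :
    x.1 + 1 / 2 ∈ II (2 * m - 1) := by
  obtain ⟨k, hk, hk'⟩ := exists_eq_natCast_sub x
  obtain ⟨l, hl, hl'⟩ := exists_eq_natCast_sub y
  have h : (l : ℚ) = k + 1 := by rw [hk', hl'] at hxy; linarith
  have h' : l = k + 1 := by exact_mod_cast h
  refine Finset.mem_image.2 ⟨k, Finset.mem_range.2 (by omega), ?_⟩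
  rw [hk', Nat.cast_sub (by omega)]; push_cast; ring

theorem step_eq_zero_iff {x y : SubI (2 * m)} (hxy : y.1 = x.1 + 1) :
    x.1 + 1 / 2 = 0 ↔ negS x = y := by
  rw [subI_ext_iff, hxy]
  change _ ↔ -x.1 = x.1 + 1
  constructor <;> intro h <;> linarith

theorem exists_middle_step (hm : 1 ≤ m) :
    ∃ x y : SubI (2 * m), y.1 = x.1 + 1 ∧ negS x = y := by
  obtain ⟨x, y, hxy, h⟩ := exists_step_of_mem_II (m := m) (i := 0)
    (Finset.mem_image.2 ⟨m - 1, Finset.mem_range.2 (by omega), by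
      rw [Nat.cast_sub hm, Nat.cast_sub (by omega)]; push_cast; ring⟩)
  exact ⟨x, y, hxy, (step_eq_zero_iff hxy).1 h.symm⟩

theorem commute_of_commute_toMat {M : ℕ} {a b : Module.End K (TV n M)}
    (h : Commute (toMat n M a) (toMat n M b)) : Commute a b :=
  (toMat n M).injective (by rw [map_mul, map_mul]; exact h)

theorem commute_calD_diagonal (r : SubI (2 * m)) (e : ℤ) (hn : 0 < n) :
    Commute (sigma0 hn) (calD n (2 * m) r.1 e) := by
  refine commute_of_commute_toMat ?_
  rw [toMat_sigma0, toMat_calD]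
  refine commute_flip_tens hn negS_involutive
    (commute_heckeMatrix_diagonal negS_involutive _ fun a => ?_)
  have h1 : negS a = r ↔ a = negS r :=
    ⟨fun h => by rw [← h, negS_involutive], fun h => by rw [h, negS_involutive]⟩
  rw [h1, negS_involutive.injective.eq_iff, add_comm]

theorem commute_gens (hm : 1 ≤ m) (hn : 0 < n) : ∀ a ∈ gensAι m n, ∀ s ∈ gensH n (2 * m) hn,
    Commute a s := by
  rintro a ha s ⟨i, hi, rfl⟩
  refine Commute.symm ?_
  obtain ⟨x₀, y₀, hxy₀, hx₀⟩ := exists_middle_step hm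
  rw [sigmaB]
  split_ifs with h0
  · rcases ha with ⟨j, hj, hj0, rfl⟩ | rfl | ⟨r, hr, -, h⟩
    · obtain ⟨x, y, hxy, rfl⟩ := exists_step_of_mem_II hj
      exact commute_of_commute_toMat
        (commute_flip_calB n hn hxy ((step_eq_zero_iff hxy).not.1 hj0))
    · exact commute_of_commute_toMat (commute_flip_calB0 n hn hxy₀ hx₀)
    · rcases h with rfl | rfl <;> exact commute_calD_diagonal ⟨r, hr⟩ _ hn
  · have hab : (⟨i - 1, by omega⟩ : Fin n).val + 1 = (⟨i, hi⟩ : Fin n).val := by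
      simp only; omega
    have hne : (⟨i - 1, by omega⟩ : Fin n) ≠ ⟨i, hi⟩ := fun h => by rw [h] at hab; omega
    refine commute_of_commute_toMat ?_
    rw [toMat_sigmaI]
    rcases ha with ⟨j, hj, -, rfl⟩ | rfl | ⟨r, hr, -, h⟩
    · obtain ⟨x, y, hxy, rfl⟩ := exists_step_of_mem_II hj
      rw [toMat_calB hxy]
      exact (commute_swap_sum_raise hxy hab).add_right (commute_swap_sum_lower hxy hab)
    · rw [toMat_calB0 hxy₀ n hx₀]
      refine ((commute_swap_sum_raise hxy₀ hab).add_right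
        ((commute_swap_sum_skewTens hab (commute_swap_one _) (commute_swap_diagonal _ _)
          ?_).smul_right _)).add_right (commute_swap_tens hne (commute_swap_diagonal _ _))
      rw [Matrix.smul_kronecker, Matrix.kronecker_smul, ← smul_add]
      exact (commute_swap_lower hxy₀).smul_right q
    · rcases h with rfl | rfl <;>
      · rw [toMat_calD n ⟨r, hr⟩]
        exact commute_swap_tens hne (commute_swap_diagonal _ _)

theorem commute_adjoin_gens (hm : 1 ≤ m) (hn : 0 < n) :
    ∀ a ∈ Algebra.adjoin K (gensAι m n), ∀ s ∈ Algebra.adjoin K (gensH n (2 * m) hn),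
      a * s = s * a := by
  intro a ha s hs
  have h1 : Algebra.adjoin K (gensAι m n) ≤ Subalgebra.centralizer K (gensH n (2 * m) hn) :=
    Algebra.adjoin_le fun b hb =>
      (Subalgebra.mem_centralizer_iff K).2 fun t ht => (commute_gens hm hn b hb t ht).eq.symm
  have h2 : Algebra.adjoin K (gensH n (2 * m) hn) ≤ Subalgebra.centralizer K {a} :=
    Algebra.adjoin_le fun t ht => (Subalgebra.mem_centralizer_iff K).2 fun b hb => by
      rw [Set.mem_singleton_iff.1 hb]
      exact ((Subalgebra.mem_centralizer_iff K).1 (h1 ha) t ht).symm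
  exact (Subalgebra.mem_centralizer_iff K).1 (h2 hs) a rfl

end Generators

section Specializations

variable {m n : ℕ}

theorem hasValue_swapWeight {M : ℕ} (c : SubI M × SubI M) : HasValue (swapWeight c) 0 := by
  rw [swapWeight]
  split_ifs
  · exact HasValue.zero
  · simpa using HasValue.q_inv.sub HasValue.one
  · simpa using HasValue.q_inv.sub HasValue.q

theorem hasValue_flipWeight {M : ℕ} (a : SubI M) : HasValue (flipWeight a) 0 := by
  rw [flipWeight]
  split_ifs
  · exact HasValue.zero
  · simpa using HasValue.q_inv.sub HasValue.q

theorem hasValue_stepDiag {M : ℕ} (x y c : SubI M) : HasValue (stepDiag x y c) 1 := by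
  rw [stepDiag]
  split_ifs
  · exact HasValue.q
  · exact HasValue.q_inv
  · exact HasValue.one

theorem mem_specialize_of_specializes_smul_sub_one {A I : Type*} [Ring A] [Algebra K A] [Fintype I]
    [DecidableEq I] {Ψ : A ≃ₐ[K] Matrix I I K} {U : Subalgebra K A} {a : A} (ha : a ∈ U) (c : K)
    {x : Matrix I I ℚ} (h : Specializes (c • (Ψ a - 1)) x) : x ∈ specialize Ψ U :=
  mem_specialize_of_specializes (a := c • (a - 1)) (U.smul_mem (sub_mem ha (one_mem U)) c)
    (by rwa [map_smul, map_sub, map_one])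

theorem Specializes.one {I : Type*} [Fintype I] [DecidableEq I] :
    Specializes (1 : Matrix I I K) 1 := by
  simpa using Specializes.diagonal (I := I) (d := fun _ => 1) fun _ => HasValue.one

theorem Specializes.sub {I : Type*} [Fintype I] {A B : Matrix I I K} {x y : Matrix I I ℚ}
    (hA : Specializes A x) (hB : Specializes B y) : Specializes (A - B) (x - y) :=
  fun i j => (hA i j).sub (hB i j)

theorem coxeterMatrices_mem_specialize (hn : 0 < n) :
    ∀ g ∈ coxeterMatrices (negS : SubI (2 * m) → _) hn,
      g ∈ specialize (toMat n (2 * m)) (Algebra.adjoin K (gensH n (2 * m) hn)) := by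
  rintro g (rfl | ⟨a, b, hab, rfl⟩)
  · refine mem_specialize_of_specializes (a := sigmaB hn 0 hn)
      (Algebra.subset_adjoin (show _ ∈ gensH n (2 * m) hn from ⟨0, hn, rfl⟩)) ?_
    rw [sigmaB, if_pos rfl, toMat_sigma0]
    exact Specializes.heckeMatrix _ fun _ => hasValue_flipWeight _
  · refine mem_specialize_of_specializes (a := sigmaB hn b.val b.2)
      (Algebra.subset_adjoin (show _ ∈ gensH n (2 * m) hn from ⟨b.val, b.2, rfl⟩)) ?_
    have ha : (⟨b.val - 1, by omega⟩ : Fin n) = a := Fin.ext (by simp only; omega)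
    rw [sigmaB, if_neg (by omega), toMat_sigmaI, ha]
    exact Specializes.heckeMatrix _ fun _ => hasValue_swapWeight _

theorem diagAction_step_mem {x y : SubI (2 * m)} (hxy : y.1 = x.1 + 1) :
    diagAction (signedUnit negS ℚ y x) ∈
      specialize (toMat n (2 * m)) (Algebra.adjoin K (gensAι m n)) := by
  by_cases hx : negS x = y
  · have hy : negS y = x := by rw [← hx, negS_involutive]
    refine mem_specialize_of_specializes_smul_sub_one (a := calB0 n (2 * m))
      (Algebra.subset_adjoin (show _ ∈ gensAι m n from Or.inr (Or.inl rfl))) 1 ?_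
    rw [one_smul, toMat_calB0 hxy n hx, signedUnit, hx, hy, map_add]
    have hE : Specializes (q • Matrix.single x y (1 : K)) (Matrix.single x y 1) :=
      (Specializes.single x y).smul HasValue.q
    have hD := Specializes.diagonal fun a => hasValue_stepDiag x y a
    have h := ((Specializes.sum_skewTens (n := n) Specializes.one (Specializes.single y x) hD).add
      ((Specializes.sum_skewTens (n := n) Specializes.one hE hD).smul HasValue.q_inv)).add
        ((Specializes.tens (ι := Fin n) fun _ => hD).sub Specializes.one)
    have h1 : tens (fun _ : Fin n => (1 : Matrix (SubI (2 * m)) (SubI (2 * m)) ℚ)) = 1 :=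
      map_one tens
    rw [h1, sub_self, add_zero, ← add_sub_assoc] at h
    exact h
  · refine mem_specialize_of_specializes (a := calB n (2 * m) (x.1 + 1 / 2))
      (Algebra.subset_adjoin (show _ ∈ gensAι m n from
        Or.inl ⟨_, step_mem_II hxy, (step_eq_zero_iff hxy).not.2 hx, rfl⟩)) ?_
    rw [toMat_calB hxy, signedUnit, map_add]
    have hD := Specializes.diagonal fun a => hasValue_stepDiag x y a
    refine (Specializes.sum_skewTens Specializes.one (Specializes.single y x) hD).add
      (Specializes.sum_skewTens (Specializes.diagonal fun a => ?_)
        ((Specializes.single _ _).smul (hasValue_stepDiag _ _ _)) hD)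
    simpa using (hasValue_stepDiag x y (negS a)).mul (hasValue_stepDiag x y a)

theorem diagAction_diagonal_mem_of_pos {r : SubI (2 * m)} (hr : 0 < r.1) :
    diagAction (signedUnit negS ℚ r r) ∈
      specialize (toMat n (2 * m)) (Algebra.adjoin K (gensAι m n)) := by
  refine mem_specialize_of_specializes_smul_sub_one (a := calD n (2 * m) r.1 1)
    (Algebra.subset_adjoin (show _ ∈ gensAι m n from
      Or.inr (Or.inr ⟨r.1, r.2, hr, Or.inl rfl⟩))) (q - 1)⁻¹ ?_
  have h := specializes_divided_difference (ι := Fin n) fun a : SubI (2 * m) =>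
    (if a = r then 1 else 0) + (if a = negS r then 1 else 0)
  have h1 : (Matrix.diagonal fun a : SubI (2 * m) =>
      (((if a = r then 1 else 0) + (if a = negS r then 1 else 0) : ℕ) : ℚ)) =
      signedUnit negS ℚ r r := by
    ext k l
    simp only [signedUnit, Matrix.diagonal_apply, Matrix.add_apply, Matrix.single_apply]
    by_cases hkl : k = l
    · subst hkl
      simp [eq_comm]
    · have h2 : ∀ s, ¬ (s = k ∧ s = l) := fun s hs => hkl (by rw [← hs.1, hs.2])
      simp [hkl, h2]
  rw [h1] at h
  rw [toMat_calD]
  convert h using 8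
  rw [one_mul, ← zpow_natCast]
  push_cast
  rfl

theorem diagAction_diagonal_mem (r : SubI (2 * m)) :
    diagAction (signedUnit negS ℚ r r) ∈
      specialize (toMat n (2 * m)) (Algebra.adjoin K (gensAι m n)) := by
  rcases lt_or_gt_of_ne (ne_zero_of_even r) with h | h
  · rw [← signedUnit_neg negS_involutive]
    exact diagAction_diagonal_mem_of_pos (neg_pos.2 h)
  · exact diagAction_diagonal_mem_of_pos h

/-- The enumeration of `𝕀_{2m}` in increasing order. -/
def coord (hm : 1 ≤ m) (k : ℕ) : SubI (2 * m) :=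
  ⟨_, natCast_sub_mem_II (k := min k (2 * m - 1)) (by omega)⟩

theorem coord_val (hm : 1 ≤ m) {k : ℕ} (hk : k < 2 * m) :
    (coord hm k).1 = (k : ℚ) - (((2 * m : ℕ) : ℚ) - 1) / 2 := by
  change ((min k (2 * m - 1) : ℕ) : ℚ) - _ = _
  rw [min_eq_left (by omega)]

theorem mem_specialize_of_commutes_coxeterMatrices (hm : 1 ≤ m) (hn : 0 < n)
    {x : Matrix (Fin n → SubI (2 * m)) (Fin n → SubI (2 * m)) ℚ}
    (hx : ∀ g ∈ coxeterMatrices negS hn, x * g = g * x) :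
    x ∈ specialize (toMat n (2 * m)) (Algebra.adjoin K (gensAι m n)) := by
  refine mem_of_commutes_coxeterMatrices (m := m) hn (coord hm) (fun s => ?_) (fun a ha b hb h => ?_)
    negS_involutive (fun k hk => ?_) _ (fun k _ => diagAction_diagonal_mem _)
    (fun k hk => diagAction_step_mem ?_) hx
  · obtain ⟨k, hk, h⟩ := exists_eq_natCast_sub s
    exact ⟨k, hk, Subtype.ext ((coord_val hm hk).trans h.symm)⟩
  · have h' := congrArg Subtype.val h
    rw [coord_val hm ha, coord_val hm hb, sub_left_inj] at h'
    exact_mod_cast h'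
  · refine Subtype.ext ?_
    rw [coord_val hm (by omega)]
    change -(coord hm k).1 = _
    rw [coord_val hm hk, Nat.cast_sub (by omega), Nat.cast_sub (by omega)]
    push_cast
    ring
  · rw [coord_val hm hk, coord_val hm (by omega)]
    push_cast
    ring

theorem double_centralizer (hm : 1 ≤ m) (hn : 0 < n) :
    Subalgebra.centralizer K (Algebra.adjoin K (gensAι m n) : Set (Module.End K (TV n (2 * m))))
      = Algebra.adjoin K (gensH n (2 * m) hn) ∧
    Subalgebra.centralizer K
        (Algebra.adjoin K (gensH n (2 * m) hn) : Set (Module.End K (TV n (2 * m))))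
      = Algebra.adjoin K (gensAι m n) := by
  have hG : ∀ g ∈ coxeterMatrices (negS (M := 2 * m)) hn, g.transpose = g := by
    rintro g (rfl | ⟨a, b, hab, rfl⟩)
    · exact heckeMatrix_transpose (flipAt_involutive negS_involutive _) _
    · exact heckeMatrix_transpose (swap_involutive a b) _
  have h := @centralizer_eq_of_specialize (Fin n → SubI (2 * m)) (Module.End K (TV n (2 * m)))
    _ _ _ _ (toMat n (2 * m)) (Algebra.adjoin K (gensAι m n))
    (Algebra.adjoin K (gensH n (2 * m) hn))
  have h' := h (commute_adjoin_gens hm hn) _ hG (coxeterMatrices_mem_specialize hn)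
  exact h' fun x hx => mem_specialize_of_commutes_coxeterMatrices hm hn hx

end Specializations

end IotaSchur

theorem stmt7 (m n : ℕ) (hm : 1 ≤ m) (hn : 0 < n) :
    -- (1) each U^ı_m-operator commutes with each σ_i
    (∀ a ∈ gensAι m n, ∀ s ∈ gensH n (2*m) hn, Commute a s) ∧
    -- (2) the commutant of the algebra generated by the U^ı_m-operators is the Hecke algebra
    Subalgebra.centralizer K
        ((Algebra.adjoin K (gensAι m n) : Subalgebra K (Module.End K (TV n (2*m)))) : Set (Module.End K (TV n (2*m))))
      = Algebra.adjoin K (gensH n (2*m) hn) ∧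
    -- (3) the commutant of the Hecke algebra is the algebra generated by the U^ı_m-operators
    Subalgebra.centralizer K
        ((Algebra.adjoin K (gensH n (2*m) hn) : Subalgebra K (Module.End K (TV n (2*m)))) : Set (Module.End K (TV n (2*m))))
      = Algebra.adjoin K (gensAι m n) :=
  ⟨IotaSchur.commute_gens hm hn, IotaSchur.double_centralizer hm hn⟩

end
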